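/- arXiv:1409.2410 — 2 statements merged into one kernel-verified Lean document; each statement's English description precedes it below -/
import Mathlib

section
/- Let ρ > 0, γ > 0, α > 0, 0 < s ≤ 1, and let {b_j}_{j=1}^∞ be the ρ-lattice of ℂⁿ. Let ν be a positive Borel measure on ℂⁿ (with ν̃_α(b_j) < ∞ for all j) and Φ a symmetric norming function. Then e^{-sγ²α(2n)} · Φ({(ν̂_γ(b_j))^s}_{j=1}^∞) ≤ Φ({(ν̃_α(b_j))^s}_{j=1}^∞) ≤ C · Φ({(ν̂_ρ(b_j))^s}_{j=1}^∞), where C = e^{sα4n²ρ²} · Σ_{m=0}^∞ (2m+1)^{2n} e^{-sαρ²(m−2n)²} (a convergent series). -/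
open MeasureTheory
noncomputable section

/-! ### Symmetric norming functions -/

/-- A real sequence with finitely many nonzero terms (an element of `ĉ`). -/
def FinSupp (ξ : ℕ → ℝ) : Prop := {j | ξ j ≠ 0}.Finite

/-- A symmetric norming function: a norm on `ĉ` with `Φ(1,0,…) = 1` which is invariant
under permutations and absolute values. -/
structure SymmNormingFun where
  toFun : (ℕ → ℝ) → ℝ
  nonneg : ∀ ξ, FinSupp ξ → 0 ≤ toFun ξ
  eq_zero_iff : ∀ ξ, FinSupp ξ → (toFun ξ = 0 ↔ ξ = 0)
  add_le : ∀ ξ η, FinSupp ξ → FinSupp η → toFun (ξ + η) ≤ toFun ξ + toFun η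
  smul_eq : ∀ (c : ℝ) (ξ), FinSupp ξ → toFun (c • ξ) = |c| * toFun ξ
  normalized : toFun (fun j => if j = 0 then 1 else 0) = 1
  symm : ∀ (θ : Equiv.Perm ℕ) (ξ), FinSupp ξ → toFun ξ = toFun fun j => |ξ (θ j)|

/-- The extension of a symmetric norming function to arbitrary real sequences, with values
in `[0,∞]`, as the (monotone) limit of its values on truncations. -/
def SymmNormingFun.ext (Φ : SymmNormingFun) (ξ : ℕ → ℝ) : ENNReal :=
  ⨆ m : ℕ, ENNReal.ofReal (Φ.toFun fun j => if j < m then ξ j else 0)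

/-- Equivalence of symmetric norming functions: each is bounded by a constant multiple of
the other on `ĉ`. -/
def SymmNormingFun.Equiv (Φ Ψ : SymmNormingFun) : Prop :=
  (∃ C : ℝ, 0 < C ∧ ∀ ξ, FinSupp ξ → Φ.toFun ξ ≤ C * Ψ.toFun ξ) ∧
  (∃ C : ℝ, 0 < C ∧ ∀ ξ, FinSupp ξ → Ψ.toFun ξ ≤ C * Φ.toFun ξ)

/-! ### Geometry and measures on `ℂⁿ` -/

/-- `ℂⁿ` with the Euclidean norm. -/
abbrev Cn (n : ℕ) := EuclideanSpace ℂ (Fin n)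

/-- `|z|_∞`: the maximum over the coordinates of the absolute values of the real and
imaginary parts. -/
def infNorm {n : ℕ} (z : Cn n) : ℝ := ⨆ i : Fin n, max |(z i).re| |(z i).im|

/-- `B(z,δ) = {w : |w − z|_∞ < δ}`. -/
def infBall {n : ℕ} (z : Cn n) (δ : ℝ) : Set (Cn n) := {w | infNorm (w - z) < δ}

/-- The set `r(ℤ + iℤ)ⁿ ⊆ ℂⁿ`. -/
def latticeSet (n : ℕ) (r : ℝ) : Set (Cn n) :=
  {z | ∀ i, ∃ a b : ℤ, z i = r * (a + b * Complex.I)}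

/-- `a : ℕ → ℂⁿ` is an enumeration of the `r`-lattice of `ℂⁿ`. -/
def IsLattice (n : ℕ) (r : ℝ) (a : ℕ → Cn n) : Prop :=
  Function.Injective a ∧ Set.range a = latticeSet n r

instance (n : ℕ) : MeasurableSpace (Cn n) := borel _
instance (n : ℕ) : BorelSpace (Cn n) := ⟨rfl⟩

/-- Lebesgue measure `dV` on `ℂⁿ`. -/
noncomputable instance (n : ℕ) : MeasureSpace (Cn n) :=
  ⟨Measure.map (WithLp.equiv 2 (Fin n → ℂ)).symm volume⟩

/-- `ν̂_r(z) = ν(B(z,r))`, as an extended real. -/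
def nuHatE {n : ℕ} (ν : Measure (Cn n)) (r : ℝ) (z : Cn n) : ENNReal := ν (infBall z r)

/-- `ν̂_r(z) = ν(B(z,r))`, as a real number. -/
def nuHat {n : ℕ} (ν : Measure (Cn n)) (r : ℝ) (z : Cn n) : ℝ := (nuHatE ν r z).toReal

/-- `ν̃_α(z) = ∫ e^{-α|z−w|²} dν(w)`, as an extended real. -/
def nuTildeE {n : ℕ} (ν : Measure (Cn n)) (α : ℝ) (z : Cn n) : ENNReal :=
  ∫⁻ w, ENNReal.ofReal (Real.exp (-α * ‖z - w‖ ^ 2)) ∂ν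

/-- `ν̃_α(z) = ∫ e^{-α|z−w|²} dν(w)`, as a real number. -/
def nuTilde {n : ℕ} (ν : Measure (Cn n)) (α : ℝ) (z : Cn n) : ℝ := (nuTildeE ν α z).toReal

namespace SymmNormingFun

variable (Φ : SymmNormingFun)

/-- The truncation of a sequence to its first `m` terms. -/
def trunc (m : ℕ) (ξ : ℕ → ℝ) : ℕ → ℝ := fun j => if j < m then ξ j else 0

theorem finSupp_trunc (m : ℕ) (ξ : ℕ → ℝ) : FinSupp (trunc m ξ) :=
  (Set.finite_Iio m).subset fun j hj => by
    by_contra h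
    exact hj (if_neg h)

theorem finSupp_of_abs_le {ξ η : ℕ → ℝ} (hη : FinSupp η) (h : ∀ j, |ξ j| ≤ |η j|) :
    FinSupp ξ :=
  hη.subset fun j hj h0 => hj (by simpa [h0] using h j)

theorem finSupp_comp {ξ : ℕ → ℝ} (hξ : FinSupp ξ) (θ : Equiv.Perm ℕ) :
    FinSupp fun j => ξ (θ j) :=
  Set.Finite.preimage θ.injective.injOn hξ

theorem toFun_abs {ξ : ℕ → ℝ} (hξ : FinSupp ξ) : Φ.toFun (fun j => |ξ j|) = Φ.toFun ξ :=
  (Φ.symm (Equiv.refl ℕ) ξ hξ).symm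

theorem toFun_comp {ξ : ℕ → ℝ} (hξ : FinSupp ξ) (θ : Equiv.Perm ℕ) :
    Φ.toFun (fun j => ξ (θ j)) = Φ.toFun ξ :=
  (Φ.toFun_abs (finSupp_comp hξ θ)).symm.trans (Φ.symm θ ξ hξ).symm

theorem toFun_update_le {η : ℕ → ℝ} (hη : FinSupp η) {j : ℕ} {x : ℝ} (hx : |x| ≤ |η j|) :
    Φ.toFun (Function.update η j x) ≤ Φ.toFun η := by
  obtain ⟨t, ht, rfl⟩ : ∃ t : ℝ, |t| ≤ 1 ∧ x = t * η j := by
    rcases eq_or_ne (η j) 0 with h | h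
    · exact ⟨0, by simp, by simpa [h] using hx⟩
    · refine ⟨x / η j, ?_, by field_simp⟩
      rw [abs_div]
      exact div_le_one_of_le₀ hx (abs_nonneg _)
  obtain ⟨ht₁, ht₂⟩ := abs_le.1 ht
  have habs : ∀ k, |Function.update η j (-η j) k| = |η k| := by
    intro k
    rcases eq_or_ne k j with rfl | hk
    · simp
    · simp [hk]
  have hflip : FinSupp (Function.update η j (-η j)) :=
    finSupp_of_abs_le hη fun k => (habs k).le
  have hΦ : Φ.toFun (Function.update η j (-η j)) = Φ.toFun η := by
    rw [← Φ.toFun_abs hflip, ← Φ.toFun_abs hη, funext habs]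
  have hsmul : ∀ (c : ℝ) {ζ : ℕ → ℝ}, FinSupp ζ → FinSupp (c • ζ) := fun c ζ hζ =>
    hζ.subset fun k hk h0 => hk (by simp [h0])
  have hdecomp : Function.update η j (t * η j) =
      ((1 + t) / 2) • η + ((1 - t) / 2) • Function.update η j (-η j) := by
    funext k
    rcases eq_or_ne k j with rfl | hk
    · simp
      ring
    · simp [hk]
      ring
  calc Φ.toFun (Function.update η j (t * η j))
      ≤ Φ.toFun (((1 + t) / 2) • η) +
          Φ.toFun (((1 - t) / 2) • Function.update η j (-η j)) := by
        rw [hdecomp]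
        exact Φ.add_le _ _ (hsmul _ hη) (hsmul _ hflip)
    _ = Φ.toFun η := by
        rw [Φ.smul_eq _ _ hη, Φ.smul_eq _ _ hflip, hΦ, abs_of_nonneg (by linarith),
          abs_of_nonneg (by linarith)]
        ring

theorem toFun_mono {ξ η : ℕ → ℝ} (hη : FinSupp η) (h : ∀ j, |ξ j| ≤ |η j|) :
    Φ.toFun ξ ≤ Φ.toFun η := by
  classical
  have key : ∀ S : Finset ℕ, Φ.toFun (fun j => if j ∈ S then ξ j else η j) ≤ Φ.toFun η := by
    intro S
    induction S using Finset.induction_on with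
    | empty => simp
    | insert a S ha ih =>
      have hfin : FinSupp (fun j => if j ∈ S then ξ j else η j) :=
        finSupp_of_abs_le hη fun j => by split_ifs <;> simp [h j]
      refine le_trans (le_of_eq_of_le ?_
        (Φ.toFun_update_le hfin (j := a) (x := ξ a) (by simpa [ha] using h a))) ih
      congr 1
      funext j
      rcases eq_or_ne j a with rfl | hj
      · simp
      · simp [hj]
  refine le_of_eq_of_le ?_ (key hη.toFinset)
  congr 1
  funext j
  by_cases hj : η j = 0
  · have h0 : ξ j = 0 := by simpa [hj] using h j
    simp [hj, h0]
  · exact (if_pos (hη.mem_toFinset.2 hj)).symm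

theorem toFun_single (j : ℕ) (x : ℝ) : Φ.toFun (Pi.single j x) = |x| := by
  have h1 : FinSupp (fun j => if j = 0 then (1 : ℝ) else 0) :=
    (Set.finite_singleton 0).subset fun k hk => by
      by_contra h
      exact hk (if_neg h)
  have hx : (Pi.single j x : ℕ → ℝ) =
      x • fun k => (fun j => if j = 0 then (1 : ℝ) else 0) (Equiv.swap j 0 k) := by
    funext k
    have : Equiv.swap j 0 k = 0 ↔ k = j := by
      rw [Equiv.swap_apply_eq_iff, Equiv.swap_apply_right]
    simp [this, Pi.single_apply]
  rw [hx, Φ.smul_eq _ _ (finSupp_comp h1 _), Φ.toFun_comp h1, Φ.normalized, mul_one]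

theorem ofReal_toFun_trunc_le_ext (m : ℕ) (ξ : ℕ → ℝ) :
    ENNReal.ofReal (Φ.toFun (trunc m ξ)) ≤ Φ.ext ξ :=
  le_iSup (fun m => ENNReal.ofReal (Φ.toFun (trunc m ξ))) m

theorem ext_le {ξ : ℕ → ℝ} {C : ENNReal}
    (h : ∀ m, ENNReal.ofReal (Φ.toFun (trunc m ξ)) ≤ C) : Φ.ext ξ ≤ C :=
  iSup_le h

theorem ofReal_toFun_le_ext {ξ η : ℕ → ℝ} (hξ : FinSupp ξ) (h : ∀ j, |ξ j| ≤ |η j|) :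
    ENNReal.ofReal (Φ.toFun ξ) ≤ Φ.ext η := by
  obtain ⟨N, hN⟩ := hξ.bddAbove
  refine le_trans (ENNReal.ofReal_le_ofReal (Φ.toFun_mono (finSupp_trunc (N + 1) η) ?_))
    (Φ.ofReal_toFun_trunc_le_ext (N + 1) η)
  intro j
  by_cases hj : ξ j = 0
  · simp [hj]
  · have : j < N + 1 := Nat.lt_succ_of_le (hN hj)
    simpa [trunc, this] using h j

theorem ext_mono {ξ η : ℕ → ℝ} (h : ∀ j, |ξ j| ≤ |η j|) : Φ.ext ξ ≤ Φ.ext η :=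
  Φ.ext_le fun m => Φ.ofReal_toFun_le_ext (finSupp_trunc m ξ) fun j => by
    rw [trunc]
    split_ifs
    · exact h j
    · simp

theorem ofReal_abs_le_ext (ξ : ℕ → ℝ) (j : ℕ) : ENNReal.ofReal |ξ j| ≤ Φ.ext ξ := by
  rw [← Φ.toFun_single j (ξ j)]
  refine Φ.ofReal_toFun_le_ext ((Set.finite_singleton j).subset fun k hk => ?_) fun k => ?_
  · by_contra h
    exact hk (Pi.single_eq_of_ne h _)
  · rcases eq_or_ne k j with rfl | hk
    · simp
    · simp [hk]

theorem ofReal_toFun_trunc_comp_le_ext (θ : Equiv.Perm ℕ) (m : ℕ) (ξ : ℕ → ℝ) :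
    ENNReal.ofReal (Φ.toFun (trunc m fun j => ξ (θ j))) ≤ Φ.ext ξ := by
  rw [← Φ.toFun_comp (finSupp_trunc m _) θ.symm]
  refine Φ.ofReal_toFun_le_ext (finSupp_comp (finSupp_trunc m _) θ.symm) fun j => ?_
  rw [trunc]
  split_ifs <;> simp

theorem ofReal_mul_ext (c : ℝ) (ξ : ℕ → ℝ) :
    ENNReal.ofReal |c| * Φ.ext ξ = Φ.ext fun j => c * ξ j := by
  rw [ext, ext, ENNReal.mul_iSup]
  congr 1
  funext m
  rw [← ENNReal.ofReal_mul (abs_nonneg c)]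
  change ENNReal.ofReal (_ * Φ.toFun (trunc m ξ)) = _
  rw [← Φ.smul_eq _ _ (finSupp_trunc m ξ)]
  congr 2
  funext j
  simp [trunc]

theorem toFun_sum_le {ι : Type*} (F : Finset ι) (f : ι → ℕ → ℝ) (hf : ∀ v, FinSupp (f v)) :
    FinSupp (∑ v ∈ F, f v) ∧ Φ.toFun (∑ v ∈ F, f v) ≤ ∑ v ∈ F, Φ.toFun (f v) := by
  classical
  induction F using Finset.induction_on with
  | empty =>
    have h0 : FinSupp 0 := by simp [FinSupp]
    simp [h0, (Φ.eq_zero_iff 0 h0).2 rfl]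
  | insert a S ha ih =>
    rw [Finset.sum_insert ha, Finset.sum_insert ha]
    refine ⟨((hf a).union ih.1).subset fun j hj => ?_,
      (Φ.add_le _ _ (hf a) ih.1).trans (by gcongr; exact ih.2)⟩
    by_contra h
    simp only [Set.mem_union, Set.mem_ofPred_eq, not_or, not_not] at h
    exact hj (by rw [Pi.add_apply, h.1, h.2, add_zero])

theorem trunc_eq_sum_single (m : ℕ) (ξ : ℕ → ℝ) :
    trunc m ξ = ∑ j ∈ Finset.range m, Pi.single j (ξ j) := by
  funext k
  simp [trunc, Finset.sum_apply, Pi.single_apply]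

theorem toFun_trunc_le_sum_abs (m : ℕ) (ξ : ℕ → ℝ) :
    Φ.toFun (trunc m ξ) ≤ ∑ j ∈ Finset.range m, |ξ j| := by
  rw [trunc_eq_sum_single]
  refine (Φ.toFun_sum_le _ _ fun j => ?_).2.trans_eq (by simp [toFun_single])
  refine (Set.finite_singleton j).subset fun k hk => ?_
  by_contra h
  exact hk (Pi.single_eq_of_ne h _)

/-- A sequence dominated by a weighted sum of rearrangements of `η` has norm at most the total
weight times the norm of `η`. -/
theorem ext_le_of_le_tsum_comp {ι : Type*} {ξ η : ℕ → ℝ} {c : ι → ℝ} {θ : ι → Equiv.Perm ℕ}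
    {C : ℝ} (hC : 0 < C) (hη : ∀ j, 0 ≤ η j) (hξ : ∀ j, 0 ≤ ξ j) (hc : ∀ v, 0 ≤ c v)
    (hcC : ∑' v, ENNReal.ofReal (c v) ≤ ENNReal.ofReal C)
    (h : ∀ j, ENNReal.ofReal (ξ j) ≤ ∑' v, ENNReal.ofReal (c v * η (θ v j))) :
    Φ.ext ξ ≤ ENNReal.ofReal C * Φ.ext η := by
  rcases eq_or_ne (Φ.ext η) ⊤ with htop | htop
  · simp [htop, ENNReal.mul_top, hC]
  obtain ⟨M, hM0, hM⟩ : ∃ M : ℝ, 0 ≤ M ∧ Φ.ext η = ENNReal.ofReal M :=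
    ⟨(Φ.ext η).toReal, ENNReal.toReal_nonneg, (ENNReal.ofReal_toReal htop).symm⟩
  have hηM : ∀ j, η j ≤ M := fun j => by
    have := Φ.ofReal_abs_le_ext η j
    rw [hM, ENNReal.ofReal_le_ofReal_iff hM0, abs_of_nonneg (hη j)] at this
    exact this
  have hcs : Summable c := by
    have := ENNReal.summable_toReal (hcC.trans_lt ENNReal.ofReal_lt_top).ne
    simpa [ENNReal.toReal_ofReal (hc _)] using this
  have hcsum : ∑' v, c v ≤ C := by
    rwa [← ENNReal.ofReal_tsum_of_nonneg hc hcs, ENNReal.ofReal_le_ofReal_iff hC.le] at hcC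
  have hnn : ∀ j v, 0 ≤ c v * η (θ v j) := fun j v => mul_nonneg (hc v) (hη _)
  have hs : ∀ j, Summable fun v => c v * η (θ v j) := fun j =>
    Summable.of_nonneg_of_le (hnn j) (fun v => mul_le_mul_of_nonneg_left (hηM _) (hc v))
      (hcs.mul_right M)
  set ζ : ℕ → ℝ := fun j => ∑' v, c v * η (θ v j) with hζ
  have hξζ : ∀ j, ξ j ≤ ζ j := fun j => by
    have := h j
    rwa [← ENNReal.ofReal_tsum_of_nonneg (hnn j) (hs j),
      ENNReal.ofReal_le_ofReal_iff (tsum_nonneg (hnn j))] at this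
  refine (Φ.ext_mono (η := ζ) fun j => ?_).trans (Φ.ext_le fun m => ?_)
  · rw [abs_of_nonneg (hξ j)]
    exact (hξζ j).trans (le_abs_self _)
  rw [hM, ← ENNReal.ofReal_mul hC.le]
  refine ENNReal.ofReal_le_ofReal ?_
  have hpartial : ∀ F : Finset ι, Φ.toFun (trunc m ζ) ≤
      C * M + ∑ j ∈ Finset.range m, |ζ j - ∑ v ∈ F, c v * η (θ v j)| := by
    intro F
    have hsplit : trunc m ζ = ∑ v ∈ F, c v • trunc m (fun j => η (θ v j)) +
        trunc m (fun j => ζ j - ∑ v ∈ F, c v * η (θ v j)) := by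
      funext j
      by_cases hj : j < m <;> simp [trunc, hj, Finset.sum_apply]
    have hfs : ∀ v, FinSupp (c v • trunc m (fun j => η (θ v j))) := fun v =>
      (finSupp_trunc m (fun j => η (θ v j))).subset fun k hk h0 => hk (by simp [h0])
    obtain ⟨hfin, hle⟩ := Φ.toFun_sum_le F _ hfs
    rw [hsplit]
    refine (Φ.add_le _ _ hfin (finSupp_trunc _ _)).trans
      (add_le_add (hle.trans ?_) (Φ.toFun_trunc_le_sum_abs _ _))
    calc ∑ v ∈ F, Φ.toFun (c v • trunc m (fun j => η (θ v j)))
        ≤ ∑ v ∈ F, c v * M := by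
          refine Finset.sum_le_sum fun v _ => ?_
          rw [Φ.smul_eq _ _ (finSupp_trunc _ _), abs_of_nonneg (hc v)]
          refine mul_le_mul_of_nonneg_left ?_ (hc v)
          have := Φ.ofReal_toFun_trunc_comp_le_ext (θ v) m η
          rwa [hM, ENNReal.ofReal_le_ofReal_iff hM0] at this
      _ ≤ C * M := by
          rw [← Finset.sum_mul]
          exact mul_le_mul_of_nonneg_right ((hcs.sum_le_tsum F fun v _ => hc v).trans hcsum) hM0
  have hlim : Filter.Tendsto
      (fun F : Finset ι => C * M + ∑ j ∈ Finset.range m, |ζ j - ∑ v ∈ F, c v * η (θ v j)|)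
      Filter.atTop (nhds (C * M + ∑ j ∈ Finset.range m, |ζ j - ζ j|)) := by
    refine tendsto_const_nhds.add (tendsto_finsetSum _ fun j _ => ?_)
    exact (tendsto_const_nhds.sub (hs j).hasSum).abs
  simpa using ge_of_tendsto' hlim hpartial

end SymmNormingFun

theorem summable_pow_mul_exp_neg_mul_sub_sq {K : ℝ} (hK : 0 < K) (k : ℕ) (a : ℝ) :
    Summable fun m : ℕ => (2 * (m : ℝ) + 1) ^ k * Real.exp (-(K * ((m : ℝ) - a) ^ 2)) := by
  have h := (summable_nat_add_iff 1).2 (Real.summable_pow_mul_exp_neg_nat_mul k hK)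
  refine Summable.of_nonneg_of_le (fun m => by positivity) (fun m => ?_)
    (h.mul_left (2 ^ k * Real.exp (K * (a + 2))))
  calc (2 * (m : ℝ) + 1) ^ k * Real.exp (-(K * ((m : ℝ) - a) ^ 2))
      ≤ (2 * ((m : ℝ) + 1)) ^ k * Real.exp (K * (a + 2) + -K * ((m : ℝ) + 1)) := by
        gcongr
        · linarith
        · nlinarith [mul_nonneg hK.le (sq_nonneg ((m : ℝ) - a - 1 / 2))]
    _ = _ := by
        rw [mul_pow, Real.exp_add]
        push_cast
        ring

theorem ENNReal.rpow_tsum_le_tsum_rpow {ι : Type*} (f : ι → ENNReal) {s : ℝ} (hs0 : 0 < s)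
    (hs1 : s ≤ 1) : (∑' v, f v) ^ s ≤ ∑' v, f v ^ s := by
  classical
  have hfin : ∀ F : Finset ι, (∑ v ∈ F, f v) ^ s ≤ ∑ v ∈ F, f v ^ s := by
    intro F
    induction F using Finset.induction_on with
    | empty => simp [hs0]
    | insert a S ha ih =>
      rw [Finset.sum_insert ha, Finset.sum_insert ha]
      exact (ENNReal.rpow_add_le_add_rpow _ _ hs0.le hs1).trans (by gcongr)
  have hlim : Filter.Tendsto (fun F : Finset ι => (∑ v ∈ F, f v) ^ s) Filter.atTop
      (nhds ((∑' v, f v) ^ s)) :=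
    (ENNReal.continuous_rpow_const.tendsto _).comp ENNReal.summable.hasSum
  exact le_of_tendsto' hlim fun F => (hfin F).trans (ENNReal.sum_le_tsum F)

theorem le_infNorm {n : ℕ} (z : Cn n) (i : Fin n) : max |(z i).re| |(z i).im| ≤ infNorm z :=
  le_ciSup (f := fun i => max |(z i).re| |(z i).im|) (Set.finite_range _).bddAbove i

theorem infNorm_lt {n : ℕ} [NeZero n] {z : Cn n} {δ : ℝ}
    (h : ∀ i, |(z i).re| < δ ∧ |(z i).im| < δ) : infNorm z < δ := by
  obtain ⟨i, hi⟩ := exists_eq_ciSup_of_finite (f := fun i => max |(z i).re| |(z i).im|)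
  rw [infNorm, ← hi]
  exact max_lt (h i).1 (h i).2

theorem norm_sq_le_of_infNorm_lt {n : ℕ} {z : Cn n} {δ : ℝ} (h : infNorm z < δ) :
    ‖z‖ ^ 2 ≤ 2 * n * δ ^ 2 := by
  rw [EuclideanSpace.norm_sq_eq]
  calc ∑ i, ‖z i‖ ^ 2 ≤ ∑ _i : Fin n, 2 * δ ^ 2 := by
        refine Finset.sum_le_sum fun i _ => ?_
        have hi := (le_infNorm z i).trans_lt h
        have h1 := sq_le_sq' (neg_le_of_abs_le ((le_max_left _ _).trans hi.le))
          (le_of_abs_le ((le_max_left _ _).trans hi.le))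
        have h2 := sq_le_sq' (neg_le_of_abs_le ((le_max_right _ _).trans hi.le))
          (le_of_abs_le ((le_max_right _ _).trans hi.le))
        rw [Complex.sq_norm, Complex.normSq_apply]
        linarith
    _ = 2 * n * δ ^ 2 := by
        simp
        ring

/-- The point of the `r`-lattice with given integer coordinates. -/
def latticePoint {n : ℕ} (r : ℝ) (g : Fin n → ℤ × ℤ) : Cn n :=
  WithLp.toLp 2 fun i => (r : ℂ) * ((g i).1 + (g i).2 * Complex.I)

@[simp]
theorem latticePoint_re {n : ℕ} (r : ℝ) (g : Fin n → ℤ × ℤ) (i : Fin n) :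
    (latticePoint r g i).re = r * (g i).1 := by
  simp [latticePoint]

@[simp]
theorem latticePoint_im {n : ℕ} (r : ℝ) (g : Fin n → ℤ × ℤ) (i : Fin n) :
    (latticePoint r g i).im = r * (g i).2 := by
  simp [latticePoint]

theorem latticePoint_injective {n : ℕ} {r : ℝ} (hr : r ≠ 0) :
    Function.Injective (latticePoint (n := n) r) := by
  intro g h hgh
  funext i
  have h1 : r * (g i).1 = r * (h i).1 := by rw [← latticePoint_re, hgh, latticePoint_re]
  have h2 : r * (g i).2 = r * (h i).2 := by rw [← latticePoint_im, hgh, latticePoint_im]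
  exact Prod.ext (by exact_mod_cast mul_left_cancel₀ hr h1)
    (by exact_mod_cast mul_left_cancel₀ hr h2)

theorem range_latticePoint (n : ℕ) (r : ℝ) :
    Set.range (latticePoint (n := n) r) = latticeSet n r := by
  ext z
  constructor
  · rintro ⟨g, rfl⟩ i
    exact ⟨(g i).1, (g i).2, rfl⟩
  · intro hz
    choose a b hab using hz
    refine ⟨fun i => (a i, b i), ?_⟩
    ext i
    exact (hab i).symm

theorem exists_latticePoint_mem_infBall {n : ℕ} [NeZero n] {r : ℝ} (hr : 0 < r) (w : Cn n) :
    ∃ g, w ∈ infBall (latticePoint r g) r := by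
  have key : ∀ x : ℝ, |x - r * ⌊x / r⌋| < r := fun x => by
    have h1 := Int.floor_le (x / r)
    have h2 := Int.lt_floor_add_one (x / r)
    rw [le_div_iff₀ hr] at h1
    rw [div_lt_iff₀ hr] at h2
    rw [abs_of_nonneg (by linarith)]
    linarith
  refine ⟨fun i => (⌊(w i).re / r⌋, ⌊(w i).im / r⌋), infNorm_lt fun i => ?_⟩
  simpa using And.intro (key (w i).re) (key (w i).im)

/-- The `ℓ^∞` norm of a vector of pairs of integers. -/
def intNorm {n : ℕ} (g : Fin n → ℤ × ℤ) : ℕ :=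
  Finset.univ.sup fun i => max (g i).1.natAbs (g i).2.natAbs

theorem tsum_comp_intNorm_le (n : ℕ) (f : ℕ → ENNReal) :
    ∑' g : Fin n → ℤ × ℤ, f (intNorm g) ≤
      ∑' m : ℕ, ((2 * m + 1 : ℕ) : ENNReal) ^ (2 * n) * f m := by
  calc ∑' g : Fin n → ℤ × ℤ, f (intNorm g)
      = ∑' (g : Fin n → ℤ × ℤ) (m : ℕ), if m = intNorm g then f m else 0 := by
        simp [tsum_ite_eq]
    _ = ∑' (m : ℕ) (g : Fin n → ℤ × ℤ), if m = intNorm g then f m else 0 := ENNReal.tsum_comm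
    _ ≤ _ := by
        refine ENNReal.tsum_le_tsum fun m => ?_
        set box : Finset (Fin n → ℤ × ℤ) :=
          Fintype.piFinset fun _ => Finset.Icc (-(m : ℤ)) m ×ˢ Finset.Icc (-(m : ℤ)) m with hbox
        have hcard : box.card = (2 * m + 1) ^ (2 * n) := by
          have : (m + 1 + m : ℤ).toNat = 2 * m + 1 := by omega
          simp [hbox, this, pow_mul, pow_two]
        have hmem : ∀ g, g ∉ box → (if m = intNorm g then f m else 0) = 0 := by
          intro g hg
          refine if_neg fun hm => hg ?_
          rw [hbox, Fintype.mem_piFinset]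
          intro i
          have : max (g i).1.natAbs (g i).2.natAbs ≤ m :=
            hm ▸ Finset.le_sup (f := fun i => max (g i).1.natAbs (g i).2.natAbs)
              (Finset.mem_univ i)
          simp only [Finset.mem_product, Finset.mem_Icc]
          omega
        rw [tsum_eq_sum (s := box) fun g hg => hmem g hg]
        calc ∑ g ∈ box, (if m = intNorm g then f m else 0) ≤ ∑ _g ∈ box, f m :=
              Finset.sum_le_sum fun g _ => by split_ifs <;> simp
          _ = _ := by
              rw [Finset.sum_const, hcard, nsmul_eq_mul]
              push_cast
              rfl

theorem le_norm_latticePoint_sub_sq {n : ℕ} [NeZero n] {r : ℝ} (hr : 0 < r)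
    (g v : Fin n → ℤ × ℤ) {w : Cn n} (hw : w ∈ infBall (latticePoint r (g + v)) r) :
    r ^ 2 * (((intNorm v : ℝ) - 2 * n) ^ 2 - 4 * n ^ 2) ≤ ‖latticePoint r g - w‖ ^ 2 := by
  have hn : (1 : ℝ) ≤ n := by exact_mod_cast Nat.one_le_iff_ne_zero.2 (NeZero.ne n)
  rcases Nat.eq_zero_or_pos (intNorm v) with h0 | hpos
  · rw [h0]
    push_cast
    nlinarith [sq_nonneg ‖latticePoint r g - w‖]
  obtain ⟨i, -, hi⟩ := Finset.exists_mem_eq_sup (Finset.univ : Finset (Fin n))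
    Finset.univ_nonempty fun i => max (v i).1.natAbs (v i).2.natAbs
  have hm1 : (1 : ℝ) ≤ intNorm v := by exact_mod_cast hpos
  have hcoord : r * intNorm v - r ≤ ‖(latticePoint r g - w) i‖ := by
    have hwi := (le_infNorm _ i).trans_lt hw
    obtain ⟨h1, h2⟩ := max_lt_iff.1 hwi
    have key : ∀ (a b : ℤ) (x : ℝ), b.natAbs = intNorm v → |x - r * ((a + b : ℤ) : ℝ)| < r →
        r * intNorm v - r ≤ |r * a - x| := by
      intro a b x hb hx
      have hb' : (intNorm v : ℝ) = |(b : ℝ)| := by rw [← hb, Nat.cast_natAbs, Int.cast_abs]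
      have h3 : r * |(b : ℝ)| = |r * b| := by rw [abs_mul, abs_of_pos hr]
      have h4 : |r * b| ≤ |r * a - x| + |x - r * ((a + b : ℤ) : ℝ)| := by
        refine le_of_eq_of_le ?_ (abs_add_le _ _)
        rw [← abs_neg]
        congr 1
        push_cast
        ring
      rw [hb', h3]
      linarith
    rcases max_choice (v i).1.natAbs (v i).2.natAbs with hmax | hmax
    · refine (key (g i).1 (v i).1 (w i).re (hmax.symm.trans hi.symm) (by simpa using h1)).trans ?_
      simpa using Complex.abs_re_le_norm ((latticePoint r g - w) i)
    · refine (key (g i).2 (v i).2 (w i).im (hmax.symm.trans hi.symm) (by simpa using h2)).trans ?_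
      simpa using Complex.abs_im_le_norm ((latticePoint r g - w) i)
  have hle := hcoord.trans (PiLp.norm_apply_le (latticePoint r g - w) i)
  have hnonneg : 0 ≤ r * intNorm v - r := by nlinarith
  calc r ^ 2 * (((intNorm v : ℝ) - 2 * n) ^ 2 - 4 * n ^ 2) ≤ (r * intNorm v - r) ^ 2 := by
        rw [show r * (intNorm v : ℝ) - r = r * (intNorm v - 1) by ring, mul_pow]
        gcongr
        nlinarith
    _ ≤ _ := by gcongr

theorem ofReal_mul_nuHatE_le_nuTildeE {n : ℕ} (ν : Measure (Cn n)) {α : ℝ} (hα : 0 < α) (γ : ℝ)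
    (z : Cn n) :
    ENNReal.ofReal (Real.exp (-(γ ^ 2 * α * (2 * n)))) * nuHatE ν γ z ≤ nuTildeE ν α z := by
  rw [nuHatE, ← setLIntegral_const, nuTildeE]
  refine le_trans (setLIntegral_mono (by fun_prop) fun w hw => ?_) (setLIntegral_le_lintegral _ _)
  have h := norm_sq_le_of_infNorm_lt hw
  rw [norm_sub_rev] at h
  refine ENNReal.ofReal_le_ofReal (Real.exp_le_exp.2 ?_)
  nlinarith

theorem nuTildeE_latticePoint_le {n : ℕ} [NeZero n] (ν : Measure (Cn n)) {α r : ℝ} (hα : 0 < α)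
    (hr : 0 < r) (g : Fin n → ℤ × ℤ) :
    nuTildeE ν α (latticePoint r g) ≤ ∑' v : Fin n → ℤ × ℤ,
      ENNReal.ofReal (Real.exp (α * r ^ 2 * (4 * n ^ 2 - ((intNorm v : ℝ) - 2 * n) ^ 2))) *
        nuHatE ν r (latticePoint r (g + v)) := by
  have hcover : ⋃ v, infBall (latticePoint r (g + v)) r = Set.univ := by
    refine Set.eq_univ_of_forall fun w => Set.mem_iUnion.2 ?_
    obtain ⟨h, hh⟩ := exists_latticePoint_mem_infBall hr w
    exact ⟨h - g, by rwa [add_sub_cancel]⟩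
  rw [nuTildeE, ← setLIntegral_univ, ← hcover]
  refine (lintegral_iUnion_le _ _).trans (ENNReal.tsum_le_tsum fun v => ?_)
  rw [nuHatE, ← setLIntegral_const]
  refine setLIntegral_mono measurable_const fun w hw => ?_
  have h := mul_le_mul_of_nonneg_left (le_norm_latticePoint_sub_sq hr g v hw) hα.le
  refine ENNReal.ofReal_le_ofReal (Real.exp_le_exp.2 ?_)
  linarith

theorem tsum_ofReal_exp_intNorm_le (n : ℕ) {K : ℝ} (hK : 0 < K) :
    ∑' v : Fin n → ℤ × ℤ,
        ENNReal.ofReal (Real.exp (K * (4 * n ^ 2 - ((intNorm v : ℝ) - 2 * n) ^ 2))) ≤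
      ENNReal.ofReal (Real.exp (K * 4 * n ^ 2) *
        ∑' m : ℕ, (2 * (m : ℝ) + 1) ^ (2 * n) * Real.exp (-(K * ((m : ℝ) - 2 * n) ^ 2))) := by
  refine (tsum_comp_intNorm_le n fun m =>
    ENNReal.ofReal (Real.exp (K * (4 * n ^ 2 - ((m : ℝ) - 2 * n) ^ 2)))).trans_eq ?_
  rw [← tsum_mul_left, ENNReal.ofReal_tsum_of_nonneg (fun m => by positivity)
    ((summable_pow_mul_exp_neg_mul_sub_sq hK _ _).mul_left _)]
  congr 1
  funext m
  rw [← ENNReal.ofReal_natCast, ← ENNReal.ofReal_pow (Nat.cast_nonneg _),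
    ← ENNReal.ofReal_mul (by positivity), mul_left_comm, ← Real.exp_add]
  push_cast
  ring_nf

theorem IsLattice.neZero {n : ℕ} {r : ℝ} {b : ℕ → Cn n} (hb : IsLattice n r b) : NeZero n := by
  refine ⟨?_⟩
  rintro rfl
  exact zero_ne_one (hb.1 (Subsingleton.elim (b 0) (b 1)))

theorem IsLattice.exists_equiv {n : ℕ} {r : ℝ} (hr : r ≠ 0) {b : ℕ → Cn n}
    (hb : IsLattice n r b) :
    ∃ e : (Fin n → ℤ × ℤ) ≃ ℕ, ∀ g, b (e g) = latticePoint r g :=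
  ⟨((Equiv.ofInjective _ (latticePoint_injective hr)).trans
      (Equiv.setCongr ((range_latticePoint n r).trans hb.2.symm))).trans
      (Equiv.ofInjective b hb.1).symm,
    fun _ => Equiv.apply_ofInjective_symm hb.1 _⟩

theorem nuHatE_ne_top {n : ℕ} {ν : Measure (Cn n)} {α : ℝ} (hα : 0 < α) (γ : ℝ) {z : Cn n}
    (h : nuTildeE ν α z < ⊤) : nuHatE ν γ z ≠ ⊤ := by
  intro htop
  have := (ofReal_mul_nuHatE_le_nuTildeE ν hα γ z).trans_lt h
  rw [htop, ENNReal.mul_top (by simp [Real.exp_pos])] at this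
  exact lt_irrefl _ this

theorem exp_mul_nuHat_rpow_le {n : ℕ} {ν : Measure (Cn n)} {α s : ℝ} (hα : 0 < α) (hs : 0 < s)
    (γ : ℝ) {z : Cn n} (h : nuTildeE ν α z < ⊤) :
    Real.exp (-(s * γ ^ 2 * α * (2 * n))) * nuHat ν γ z ^ s ≤ nuTilde ν α z ^ s := by
  have h1 := ENNReal.toReal_mono h.ne (ofReal_mul_nuHatE_le_nuTildeE ν hα γ z)
  rw [ENNReal.toReal_mul, ENNReal.toReal_ofReal (Real.exp_nonneg _)] at h1
  have h2 := Real.rpow_le_rpow (by positivity) h1 hs.le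
  rw [Real.mul_rpow (by positivity) ENNReal.toReal_nonneg, ← Real.exp_mul] at h2
  refine le_of_eq_of_le ?_ h2
  rw [nuHat]
  ring_nf

theorem ofReal_nuTilde_rpow_le {n : ℕ} [NeZero n] {ν : Measure (Cn n)} {α r s : ℝ} (hα : 0 < α)
    (hr : 0 < r) (hs0 : 0 < s) (hs1 : s ≤ 1)
    (hfin : ∀ g, nuTildeE ν α (latticePoint r g) < ⊤) (g : Fin n → ℤ × ℤ) :
    ENNReal.ofReal (nuTilde ν α (latticePoint r g) ^ s) ≤ ∑' v : Fin n → ℤ × ℤ,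
      ENNReal.ofReal (Real.exp (s * α * r ^ 2 * (4 * n ^ 2 - ((intNorm v : ℝ) - 2 * n) ^ 2)) *
        nuHat ν r (latticePoint r (g + v)) ^ s) := by
  rw [nuTilde, ← ENNReal.ofReal_rpow_of_nonneg ENNReal.toReal_nonneg hs0.le,
    ENNReal.ofReal_toReal (hfin g).ne]
  refine ((ENNReal.rpow_le_rpow (nuTildeE_latticePoint_le ν hα hr g) hs0.le).trans
    (ENNReal.rpow_tsum_le_tsum_rpow _ hs0 hs1)).trans_eq ?_
  congr 1
  funext v
  rw [ENNReal.mul_rpow_of_nonneg _ _ hs0.le, ENNReal.ofReal_mul (Real.exp_nonneg _), nuHat,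
    ENNReal.ofReal_rpow_of_nonneg (Real.exp_nonneg _) hs0.le,
    ← ENNReal.ofReal_rpow_of_nonneg ENNReal.toReal_nonneg hs0.le,
    ENNReal.ofReal_toReal (nuHatE_ne_top hα r (hfin _)), ← Real.exp_mul]
  ring_nf

/-- **Theorem (Berezin-transform comparison).** For `ρ, γ, α > 0`, `0 < s ≤ 1`, `{b_j}` the
`ρ`-lattice of `ℂⁿ`, `ν` a positive Borel measure on `ℂⁿ` (with `ν̃_α(b_j) < ∞` for all `j`)
and `Φ` a symmetric norming function:
`e^{-sγ²α(2n)} Φ({(ν̂_γ(b_j))^s}) ≤ Φ({(ν̃_α(b_j))^s}) ≤ C Φ({(ν̂_ρ(b_j))^s})`, where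
`C = e^{sα4n²ρ²} Σ_{m=0}^∞ (2m+1)^{2n} e^{-sαρ²(m−2n)²}` (a convergent series). -/
theorem snf_berezin_comparison
    (n : ℕ) (ρ γ α s : ℝ) (hρ : 0 < ρ) (hγ : 0 < γ) (hα : 0 < α)
    (hs0 : 0 < s) (hs1 : s ≤ 1)
    (b : ℕ → Cn n) (hb : IsLattice n ρ b)
    (ν : Measure (Cn n)) (hfin : ∀ j, nuTildeE ν α (b j) < ⊤)
    (Φ : SymmNormingFun) :
    Summable (fun m : ℕ =>
      (2 * (m : ℝ) + 1) ^ (2 * n) * Real.exp (-(s * α * ρ ^ 2 * ((m : ℝ) - 2 * n) ^ 2))) ∧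
    ENNReal.ofReal (Real.exp (-(s * γ ^ 2 * α * (2 * n)))) *
        Φ.ext (fun j => nuHat ν γ (b j) ^ s) ≤
      Φ.ext (fun j => nuTilde ν α (b j) ^ s) ∧
    Φ.ext (fun j => nuTilde ν α (b j) ^ s) ≤
      ENNReal.ofReal (Real.exp (s * α * 4 * n ^ 2 * ρ ^ 2) *
          ∑' m : ℕ, (2 * (m : ℝ) + 1) ^ (2 * n) *
            Real.exp (-(s * α * ρ ^ 2 * ((m : ℝ) - 2 * n) ^ 2))) *
        Φ.ext (fun j => nuHat ν ρ (b j) ^ s) := by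
  have hK : 0 < s * α * ρ ^ 2 := by positivity
  have hsum := summable_pow_mul_exp_neg_mul_sub_sq hK (2 * n) (2 * n)
  refine ⟨hsum, ?_, ?_⟩
  · rw [← abs_of_pos (Real.exp_pos (-(s * γ ^ 2 * α * (2 * n)))), Φ.ofReal_mul_ext]
    refine Φ.ext_mono fun j => ?_
    have h0 : 0 ≤ nuHat ν γ (b j) ^ s := Real.rpow_nonneg ENNReal.toReal_nonneg _
    rw [abs_of_nonneg (by positivity)]
    exact (exp_mul_nuHat_rpow_le hα hs0 γ (hfin j)).trans (le_abs_self _)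
  · have := hb.neZero
    obtain ⟨e, he⟩ := hb.exists_equiv hρ.ne'
    refine Φ.ext_le_of_le_tsum_comp
      (c := fun v : Fin n → ℤ × ℤ =>
        Real.exp (s * α * ρ ^ 2 * (4 * n ^ 2 - ((intNorm v : ℝ) - 2 * n) ^ 2)))
      (θ := fun v => (e.symm.trans (Equiv.addRight v)).trans e)
      (mul_pos (Real.exp_pos _) (hsum.tsum_pos (fun m => by positivity) 0 (by positivity)))
      (fun j => Real.rpow_nonneg ENNReal.toReal_nonneg _)
      (fun j => Real.rpow_nonneg ENNReal.toReal_nonneg _)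
      (fun v => Real.exp_nonneg _) ?_ fun j => ?_
    · convert tsum_ofReal_exp_intNorm_le n hK using 4
      ring
    · obtain ⟨g, rfl⟩ := e.surjective j
      simpa [he] using ofReal_nuTilde_rpow_le hα hρ hs0 hs1
        (fun g => he g ▸ hfin (e g)) g
end
end

section
/- Let H be a separable complex Hilbert space, 0 < s ≤ 1, and Φ a symmetric norming function. Then there exists a constant C > 0 (depending only on Φ) such that for every sequence {H_j}_{j=1}^∞ of bounded operators on H with Σ_{j=1}^∞ ||H_j|^s|_Φ < ∞, the series Σ_{j=1}^∞ H_j converges in operator norm and ||Σ_{j=1}^∞ H_j|^s|_Φ ≤ C·2^{1-s}·Σ_{j=1}^∞ ||H_j|^s|_Φ. -/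
open MeasureTheory
noncomputable section

/-! ### s-numbers and operator powers -/

/-- The `j`-th s-number (singular number) of a bounded operator, `j = 0, 1, 2, …`
(so `sNumber A j` is `s_{j+1}(A)` in classical notation): the distance from `A` to the
set of operators of rank at most `j`. -/
def sNumber {E : Type*} [NormedAddCommGroup E] [NormedSpace ℂ E] (A : E →L[ℂ] E) (j : ℕ) : ℝ :=
  sInf {c | ∃ F : E →L[ℂ] E, Module.rank ℂ (LinearMap.range (F : E →ₗ[ℂ] E)) ≤ j ∧ c = ‖A - F‖}

/-- `T^s`, defined by the continuous functional calculus (intended for positive `T`). -/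
def opPow {H : Type*} [NormedAddCommGroup H] [InnerProductSpace ℂ H] [CompleteSpace H]
    (T : H →L[ℂ] H) (s : ℝ) : H →L[ℂ] H := cfc (fun x : ℝ => x ^ s) T

/-- `|T|^s = (T^*T)^{s/2}`, defined by the continuous functional calculus. -/
def opAbsPow {H : Type*} [NormedAddCommGroup H] [InnerProductSpace ℂ H] [CompleteSpace H]
    (T : H →L[ℂ] H) (s : ℝ) : H →L[ℂ] H := cfc (fun x : ℝ => x ^ (s / 2)) (star T * T)

/-- `|A|_Φ = Φ({s_j(A)}) ∈ [0,∞]`; by definition `A` belongs to the symmetrically-normed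
ideal `C_Φ` iff this quantity is finite. -/
def snormSNF {E : Type*} [NormedAddCommGroup E] [NormedSpace ℂ E] (Φ : SymmNormingFun)
    (A : E →L[ℂ] E) : ENNReal :=
  Φ.ext fun j => sNumber A j

/-! ### Elementary properties of approximation numbers -/

section ApproximationNumbers

variable {E : Type*} [NormedAddCommGroup E] [NormedSpace ℂ E]

lemma sNumber_bddBelow (A : E →L[ℂ] E) (j : ℕ) :
    BddBelow {c | ∃ F : E →L[ℂ] E,
      Module.rank ℂ (LinearMap.range (F : E →ₗ[ℂ] E)) ≤ j ∧ c = ‖A - F‖} :=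
  ⟨0, by rintro c ⟨F, -, rfl⟩; exact norm_nonneg _⟩

lemma rank_range_zero_le (j : ℕ) :
    Module.rank ℂ (LinearMap.range ((0 : E →L[ℂ] E) : E →ₗ[ℂ] E)) ≤ j := by
  simp

lemma sNumber_set_nonempty (A : E →L[ℂ] E) (j : ℕ) :
    {c | ∃ F : E →L[ℂ] E,
      Module.rank ℂ (LinearMap.range (F : E →ₗ[ℂ] E)) ≤ j ∧ c = ‖A - F‖}.Nonempty :=
  ⟨_, 0, rank_range_zero_le j, rfl⟩

lemma sNumber_le_norm_sub {A F : E →L[ℂ] E} {j : ℕ}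
    (hF : Module.rank ℂ (LinearMap.range (F : E →ₗ[ℂ] E)) ≤ j) : sNumber A j ≤ ‖A - F‖ :=
  csInf_le (sNumber_bddBelow A j) ⟨F, hF, rfl⟩

lemma sNumber_nonneg (A : E →L[ℂ] E) (j : ℕ) : 0 ≤ sNumber A j :=
  Real.sInf_nonneg (by rintro c ⟨F, -, rfl⟩; exact norm_nonneg _)

lemma le_sNumber {A : E →L[ℂ] E} {j : ℕ} {c : ℝ}
    (h : ∀ F : E →L[ℂ] E, Module.rank ℂ (LinearMap.range (F : E →ₗ[ℂ] E)) ≤ j → c ≤ ‖A - F‖) :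
    c ≤ sNumber A j :=
  le_csInf (sNumber_set_nonempty A j) (by rintro _ ⟨F, hF, rfl⟩; exact h F hF)

lemma exists_norm_sub_lt_of_sNumber_lt {A : E →L[ℂ] E} {j : ℕ} {c : ℝ} (h : sNumber A j < c) :
    ∃ F : E →L[ℂ] E, Module.rank ℂ (LinearMap.range (F : E →ₗ[ℂ] E)) ≤ j ∧ ‖A - F‖ < c := by
  obtain ⟨_, ⟨F, hF, rfl⟩, hc⟩ := exists_lt_of_csInf_lt (sNumber_set_nonempty A j) h
  exact ⟨F, hF, hc⟩

lemma sNumber_antitone (A : E →L[ℂ] E) : Antitone (sNumber A) := fun _ _ hij =>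
  le_sNumber fun _ hF => sNumber_le_norm_sub (hF.trans (by exact_mod_cast hij))

lemma sNumber_le_norm (A : E →L[ℂ] E) (j : ℕ) : sNumber A j ≤ ‖A‖ := by
  simpa using sNumber_le_norm_sub (A := A) (rank_range_zero_le j)

lemma sNumber_zero_eq_norm (A : E →L[ℂ] E) : sNumber A 0 = ‖A‖ := by
  refine le_antisymm (sNumber_le_norm A 0) (le_sNumber fun F hF => ?_)
  have h0 : Module.rank ℂ (LinearMap.range (F : E →ₗ[ℂ] E)) = 0 := by simpa using hF
  have h1 : LinearMap.range (F : E →ₗ[ℂ] E) = ⊥ := Submodule.rank_eq_zero.mp h0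
  have h2 : F = 0 := by
    ext x
    have : F x ∈ LinearMap.range (F : E →ₗ[ℂ] E) := ⟨x, rfl⟩
    rw [h1] at this
    simpa using this
  simp [h2]

lemma sNumber_le_add_norm_sub (A B : E →L[ℂ] E) (j : ℕ) :
    sNumber A j ≤ sNumber B j + ‖A - B‖ := by
  rw [← sub_le_iff_le_add]
  refine le_sNumber fun F hF => ?_
  rw [sub_le_iff_le_add]
  calc sNumber A j ≤ ‖A - F‖ := sNumber_le_norm_sub hF
    _ = ‖(B - F) + (A - B)‖ := by congr 1; abel
    _ ≤ _ := norm_add_le _ _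

lemma abs_sNumber_sub_le (A B : E →L[ℂ] E) (j : ℕ) :
    |sNumber A j - sNumber B j| ≤ ‖A - B‖ := by
  have h1 := sNumber_le_add_norm_sub A B j
  have h2 := sNumber_le_add_norm_sub B A j
  rw [norm_sub_rev] at h2
  rw [abs_le]
  constructor <;> linarith

lemma sNumber_add_rank_le {A R : E →L[ℂ] E} {r : ℕ}
    (hR : Module.rank ℂ (LinearMap.range (R : E →ₗ[ℂ] E)) ≤ r) (k : ℕ) :
    sNumber A (k + r) ≤ sNumber (A - R) k := by
  refine le_sNumber fun F hF => ?_
  have h : Module.rank ℂ (LinearMap.range ((F + R : E →L[ℂ] E) : E →ₗ[ℂ] E)) ≤ (k + r : ℕ) := by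
    have h1 := LinearMap.rank_add_le (F : E →ₗ[ℂ] E) (R : E →ₗ[ℂ] E)
    rw [ContinuousLinearMap.toLinearMap_add]
    push_cast
    exact h1.trans (add_le_add hF hR)
  calc sNumber A (k + r) ≤ ‖A - (F + R)‖ := sNumber_le_norm_sub h
    _ = _ := by congr 1; abel

lemma rank_range_mul_le_left (A B : E →L[ℂ] E) :
    Module.rank ℂ (LinearMap.range ((A * B : E →L[ℂ] E) : E →ₗ[ℂ] E)) ≤
      Module.rank ℂ (LinearMap.range (A : E →ₗ[ℂ] E)) :=
  LinearMap.rank_comp_le_left (B : E →ₗ[ℂ] E) (A : E →ₗ[ℂ] E)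

lemma rank_range_mul_le_right (A B : E →L[ℂ] E) :
    Module.rank ℂ (LinearMap.range ((A * B : E →L[ℂ] E) : E →ₗ[ℂ] E)) ≤
      Module.rank ℂ (LinearMap.range (B : E →ₗ[ℂ] E)) :=
  LinearMap.rank_comp_le_right (B : E →ₗ[ℂ] E) (A : E →ₗ[ℂ] E)

lemma sNumber_mul_le_right {W : E →L[ℂ] E} (hW : ‖W‖ ≤ 1) (A : E →L[ℂ] E) (k : ℕ) :
    sNumber (W * A) k ≤ sNumber A k := by
  refine le_sNumber fun F hF => ?_
  calc sNumber (W * A) k ≤ ‖W * A - W * F‖ :=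
        sNumber_le_norm_sub ((rank_range_mul_le_right W F).trans hF)
    _ = ‖W * (A - F)‖ := by rw [mul_sub]
    _ ≤ ‖W‖ * ‖A - F‖ := norm_mul_le _ _
    _ ≤ ‖A - F‖ := mul_le_of_le_one_left (norm_nonneg _) hW

lemma sNumber_mul_le_left {W : E →L[ℂ] E} (hW : ‖W‖ ≤ 1) (A : E →L[ℂ] E) (k : ℕ) :
    sNumber (A * W) k ≤ sNumber A k := by
  refine le_sNumber fun F hF => ?_
  calc sNumber (A * W) k ≤ ‖A * W - F * W‖ :=
        sNumber_le_norm_sub ((rank_range_mul_le_left F W).trans hF)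
    _ = ‖(A - F) * W‖ := by rw [sub_mul]
    _ ≤ ‖A - F‖ * ‖W‖ := norm_mul_le _ _
    _ ≤ ‖A - F‖ := mul_le_of_le_one_right (norm_nonneg _) hW

/-- A subspace of dimension larger than the rank of `F` meets the kernel of `F`. -/
lemma exists_mem_ker_of_rank_lt {V : Submodule ℂ E} {G : Type*} [AddCommGroup G] [Module ℂ G]
    {F : E →ₗ[ℂ] G} {k : ℕ} (hF : Module.rank ℂ (LinearMap.range F) ≤ k)
    (hV : (k : Cardinal) < Module.rank ℂ V) : ∃ x ∈ V, x ≠ 0 ∧ F x = 0 := by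
  by_contra! h
  have hinj : Function.Injective (F.domRestrict V) := by
    rw [← LinearMap.ker_eq_bot, LinearMap.ker_eq_bot']
    intro x hx
    by_contra hne
    exact h x x.2 (by simpa using hne) hx
  have h1 : Cardinal.lift (Module.rank ℂ V) ≤
      Cardinal.lift (Module.rank ℂ (LinearMap.range F)) :=
    LinearMap.lift_rank_le_of_injective
      ((F.domRestrict V).codRestrict (LinearMap.range F) fun x => ⟨x, rfl⟩)
      (fun x y hxy => hinj (congrArg Subtype.val hxy))
  have h2 : Cardinal.lift (Module.rank ℂ (LinearMap.range F)) ≤ (k : Cardinal) := by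
    simpa using hF
  have h3 := h1.trans h2
  rw [Cardinal.lift_le_nat_iff] at h3
  exact absurd h3 (not_le.mpr hV)

end ApproximationNumbers

/-! ### Functional calculus and approximation numbers -/

section FunctionalCalculus

variable {H : Type*} [NormedAddCommGroup H] [InnerProductSpace ℂ H] [CompleteSpace H]

open scoped InnerProductSpace

lemma nonneg_of_mem_spectrum_star_mul_self (A : H →L[ℂ] H) {x : ℝ}
    (hx : x ∈ spectrum ℝ (star A * A)) : 0 ≤ x :=
  spectrum_nonneg_of_nonneg (star_mul_self_nonneg A) hx

/-- If `κ ≤ g` wherever `h` does not vanish, then `g(P)` is bounded below by `κ` on the range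
of `h(P)`. -/
lemma mul_norm_sq_le_re_inner_cfc {P : H →L[ℂ] H} (hP : IsSelfAdjoint P) {g h : ℝ → ℝ}
    (hg : Continuous g) (hh : Continuous h) {κ : ℝ}
    (hgh : ∀ x ∈ spectrum ℝ P, h x ≠ 0 → κ ≤ g x) (y : H) :
    κ * ‖cfc h P y‖ ^ 2 ≤ (⟪cfc g P (cfc h P y), cfc h P y⟫_ℂ).re := by
  have hpos : 0 ≤ cfc (fun x => h x * ((g x - κ) * h x)) P := by
    refine cfc_nonneg fun x hx => ?_
    rcases eq_or_ne (h x) 0 with h0 | h0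
    · simp [h0]
    · nlinarith [mul_nonneg (sub_nonneg.mpr (hgh x hx h0)) (mul_self_nonneg (h x))]
  have heq : cfc (fun x => h x * ((g x - κ) * h x)) P =
      cfc h P * ((cfc g P - algebraMap ℝ _ κ) * cfc h P) := by
    rw [cfc_mul h (fun x => (g x - κ) * h x) P, cfc_mul (fun x => g x - κ) h P,
      cfc_sub g (fun _ => κ) P, cfc_const κ P]
  rw [heq, ContinuousLinearMap.nonneg_iff_isPositive] at hpos
  have h1 := hpos.re_inner_nonneg_left y
  have hsa : IsSelfAdjoint (cfc h P) := cfc_predicate h P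
  have h2 : ⟪(cfc h P * ((cfc g P - algebraMap ℝ _ κ) * cfc h P)) y, y⟫_ℂ =
      ⟪cfc g P (cfc h P y), cfc h P y⟫_ℂ - κ * ⟪cfc h P y, cfc h P y⟫_ℂ := by
    have h3 : ∀ z, ⟪cfc h P z, y⟫_ℂ = ⟪z, cfc h P y⟫_ℂ := fun z => by
      rw [← ContinuousLinearMap.adjoint_inner_right, hsa.adjoint_eq]
    simp only [mul_apply_eq_comp, h3, sub_apply, inner_sub_left,
      Algebra.algebraMap_eq_smul_one, smul_apply,
      one_apply_eq_self]
    congr 1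
    rw [← Complex.coe_smul, inner_smul_left]
    simp
  rw [h2] at h1
  have h4 : (⟪cfc h P y, cfc h P y⟫_ℂ).re = ‖cfc h P y‖ ^ 2 := by
    rw [inner_self_eq_norm_sq_to_K]; norm_cast
  simp only [map_sub, RCLike.re_to_complex, Complex.re_ofReal_mul, h4] at h1
  linarith

lemma re_inner_star_mul_self (A : H →L[ℂ] H) (x : H) :
    (⟪(star A * A) x, x⟫_ℂ).re = ‖A x‖ ^ 2 := by
  rw [mul_apply_eq_comp, ContinuousLinearMap.star_eq_adjoint,
    ContinuousLinearMap.adjoint_inner_left, inner_self_eq_norm_sq_to_K]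
  norm_cast

lemma mul_norm_le_norm_of_mem_range_cfc (A : H →L[ℂ] H) {h : ℝ → ℝ} (hh : Continuous h) {c : ℝ}
    (hc : 0 ≤ c) (hz : ∀ x, x ≤ c ^ 2 → h x = 0) (y : H) :
    c * ‖cfc h (star A * A) y‖ ≤ ‖A (cfc h (star A * A) y)‖ := by
  have hP : IsSelfAdjoint (star A * A) := .star_mul_self A
  have h1 := mul_norm_sq_le_re_inner_cfc hP continuous_id hh (κ := c ^ 2)
    (fun x _ hx => le_of_not_ge fun hle => hx (hz x hle)) y
  rw [cfc_id ℝ (star A * A), re_inner_star_mul_self, ← mul_pow] at h1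
  exact (sq_le_sq₀ (by positivity) (norm_nonneg _)).mp h1

/-- Functions of `A⋆A` supported above the `k`-th approximation number have rank at most `k`. -/
lemma rank_range_cfc_le_of_sNumber_lt {A : H →L[ℂ] H} {h : ℝ → ℝ} (hh : Continuous h) {c : ℝ}
    {k : ℕ} (hk : sNumber A k < c) (hz : ∀ x, x ≤ c ^ 2 → h x = 0) :
    Module.rank ℂ (LinearMap.range ((cfc h (star A * A) : H →L[ℂ] H) : H →ₗ[ℂ] H)) ≤ k := by
  by_contra! hlt
  obtain ⟨F, hF, hAF⟩ := exists_norm_sub_lt_of_sNumber_lt hk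
  obtain ⟨_, ⟨y, rfl⟩, hx, hFx⟩ := exists_mem_ker_of_rank_lt hF hlt
  have h1 := mul_norm_le_norm_of_mem_range_cfc A hh ((sNumber_nonneg A k).trans hk.le) hz y
  simp only [ContinuousLinearMap.coe_coe] at hx hFx
  set x := cfc h (star A * A) y
  have h2 : ‖A x‖ ≤ ‖A - F‖ * ‖x‖ := by
    simpa [hFx] using (A - F).le_opNorm x
  have h3 : 0 < ‖x‖ := norm_pos_iff.mpr hx
  nlinarith [mul_lt_mul_of_pos_right hAF h3]

/-- The function `x ↦ (1 - c / √x)₊`. -/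
def softThreshold (c x : ℝ) : ℝ := 1 - c / max c (√x)

lemma continuous_softThreshold {c : ℝ} (hc : 0 < c) : Continuous (softThreshold c) := by
  unfold softThreshold
  refine continuous_const.sub (continuous_const.div (by fun_prop) fun x => ?_)
  exact (lt_max_of_lt_left hc).ne'

lemma softThreshold_eq_zero {c x : ℝ} (hc : 0 < c) (hx : x ≤ c ^ 2) : softThreshold c x = 0 := by
  have : √x ≤ c := Real.sqrt_le_iff.mpr ⟨hc.le, hx⟩
  simp [softThreshold, max_eq_left this, hc.ne']

lemma norm_cfc_div_max_le_one (A : H →L[ℂ] H) {c : ℝ} (hc : 0 < c) :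
    ‖cfc (fun x => c / max c (√x)) (star A * A)‖ ≤ 1 := by
  refine norm_cfc_le zero_le_one fun x _ => ?_
  have h : 0 < max c (√x) := lt_max_of_lt_left hc
  rw [Real.norm_of_nonneg (by positivity), div_le_one h]
  exact le_max_left _ _

lemma sub_mul_cfc_softThreshold (A : H →L[ℂ] H) {c : ℝ} (hc : 0 < c) :
    A - A * cfc (softThreshold c) (star A * A) =
      A * cfc (fun x => c / max c (√x)) (star A * A) := by
  have hP : IsSelfAdjoint (star A * A) := .star_mul_self A
  have hcont : Continuous fun x : ℝ => c / max c (√x) :=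
    continuous_const.div (by fun_prop) fun x => (lt_max_of_lt_left hc).ne'
  have h1 : cfc (softThreshold c) (star A * A) =
      1 - cfc (fun x => c / max c (√x)) (star A * A) := by
    unfold softThreshold
    rw [cfc_sub (fun _ => (1 : ℝ)) (fun x => c / max c (√x)) (star A * A) continuousOn_const
      hcont.continuousOn, cfc_const_one ℝ (star A * A) hP]
  rw [h1, mul_sub, mul_one, sub_sub_cancel]

lemma norm_mul_cfc_div_max_le (A : H →L[ℂ] H) {c : ℝ} (hc : 0 < c) :
    ‖A * cfc (fun x => c / max c (√x)) (star A * A)‖ ≤ c := by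
  have hP : IsSelfAdjoint (star A * A) := .star_mul_self A
  have hcont : Continuous fun x : ℝ => c / max c (√x) :=
    continuous_const.div (by fun_prop) fun x => (lt_max_of_lt_left hc).ne'
  set q : ℝ → ℝ := fun x => c / max c (√x) with hq
  have hsa : IsSelfAdjoint (cfc q (star A * A)) := cfc_predicate q _
  have h1 : star (A * cfc q (star A * A)) * (A * cfc q (star A * A)) =
      cfc (fun x => q x * (x * q x)) (star A * A) := by
    rw [cfc_mul q (fun x => x * q x) (star A * A), cfc_mul (fun x => x) q (star A * A),
      cfc_id' ℝ (star A * A), star_mul, hsa.star_eq]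
    simp only [mul_assoc]
  have h2 : ‖A * cfc q (star A * A)‖ * ‖A * cfc q (star A * A)‖ ≤ c ^ 2 := by
    rw [← CStarRing.norm_star_mul_self, h1]
    refine norm_cfc_le (by positivity) fun x hx => ?_
    have hx0 := nonneg_of_mem_spectrum_star_mul_self A hx
    have hm : 0 < max c (√x) := lt_max_of_lt_left hc
    have hq0 : 0 ≤ q x := by simp only [hq]; positivity
    rw [Real.norm_of_nonneg (by positivity)]
    have h3 : √x * q x ≤ c := by
      simp only [hq]
      rw [mul_div_assoc', div_le_iff₀ hm, mul_comm]
      exact mul_le_mul_of_nonneg_left (le_max_right _ _) hc.le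
    calc q x * (x * q x) = (√x * q x) ^ 2 := by rw [mul_pow, Real.sq_sqrt hx0]; ring
      _ ≤ c ^ 2 := by gcongr
  rw [← sq] at h2
  exact (sq_le_sq₀ (norm_nonneg _) hc.le).mp h2

lemma sNumber_le_of_rank_range_cfc_le {A : H →L[ℂ] H} {c : ℝ} (hc : 0 < c) {k : ℕ}
    (hk : Module.rank ℂ (LinearMap.range
      ((cfc (softThreshold c) (star A * A) : H →L[ℂ] H) : H →ₗ[ℂ] H)) ≤ k) :
    sNumber A k ≤ c := by
  refine (sNumber_le_norm_sub ((rank_range_mul_le_right A _).trans hk)).trans ?_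
  rw [sub_mul_cfc_softThreshold A hc]
  exact norm_mul_cfc_div_max_le A hc

/-- Truncation of singular values at level `c` by subtracting an operator of rank `≤ r`. -/
lemma exists_rank_le_sNumber_sub_le {A : H →L[ℂ] H} {c : ℝ} {r : ℕ} (hr : sNumber A r < c) :
    ∃ R : H →L[ℂ] H, Module.rank ℂ (LinearMap.range (R : H →ₗ[ℂ] H)) ≤ r ∧
      ∀ k, sNumber (A - R) k ≤ min (sNumber A k) c := by
  have hc : 0 < c := (sNumber_nonneg A r).trans_lt hr
  refine ⟨A * cfc (softThreshold c) (star A * A), (rank_range_mul_le_right A _).trans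
    (rank_range_cfc_le_of_sNumber_lt (continuous_softThreshold hc) hr
      fun x hx => softThreshold_eq_zero hc hx), fun k => ?_⟩
  rw [sub_mul_cfc_softThreshold A hc]
  exact le_min (sNumber_mul_le_left (norm_cfc_div_max_le_one A hc) A k)
    ((sNumber_le_norm _ k).trans (norm_mul_cfc_div_max_le A hc))

lemma star_opAbsPow_mul_self (A : H →L[ℂ] H) {s : ℝ} (hs : 0 < s) :
    star (opAbsPow A s) * opAbsPow A s = cfc (fun x : ℝ => x ^ s) (star A * A) := by
  have hsa : IsSelfAdjoint (opAbsPow A s) := cfc_predicate _ _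
  have hcont : Continuous fun x : ℝ => x ^ (s / 2) :=
    Real.continuous_rpow_const (by positivity)
  rw [hsa.star_eq]
  unfold opAbsPow
  rw [← cfc_mul _ _ (star A * A) hcont.continuousOn hcont.continuousOn]
  refine cfc_congr fun x hx => ?_
  have hx0 := nonneg_of_mem_spectrum_star_mul_self A hx
  rw [← Real.rpow_add_of_nonneg hx0 (by positivity) (by positivity), add_halves]

lemma sNumber_opAbsPow_le (A : H →L[ℂ] H) {s : ℝ} (hs : 0 < s) (k : ℕ) :
    sNumber (opAbsPow A s) k ≤ sNumber A k ^ s := by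
  refine le_of_forall_gt_imp_ge_of_dense fun d hd => ?_
  have hd0 : 0 < d := (Real.rpow_nonneg (sNumber_nonneg A k) s).trans_lt hd
  have hP : IsSelfAdjoint (star A * A) := .star_mul_self A
  have hpow : Continuous fun x : ℝ => x ^ s := Real.continuous_rpow_const hs.le
  have hsoft := continuous_softThreshold hd0
  refine sNumber_le_of_rank_range_cfc_le hd0 ?_
  rw [star_opAbsPow_mul_self A hs, ← cfc_comp' (softThreshold d) (fun x : ℝ => x ^ s)
    (star A * A) hsoft.continuousOn hpow.continuousOn hP]
  have heq : cfc (fun x : ℝ => softThreshold d (x ^ s)) (star A * A) =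
      cfc (fun x : ℝ => softThreshold d ((max x 0) ^ s)) (star A * A) :=
    cfc_congr fun x hx => by
      simp only [max_eq_left (nonneg_of_mem_spectrum_star_mul_self A hx)]
  rw [heq]
  have hlt : sNumber A k < d ^ s⁻¹ :=
    (Real.lt_rpow_inv_iff_of_pos (sNumber_nonneg A k) hd0.le hs).mpr hd
  refine rank_range_cfc_le_of_sNumber_lt
    (hsoft.comp (hpow.comp (by fun_prop : Continuous fun x : ℝ => max x 0))) hlt fun x hx => ?_
  refine softThreshold_eq_zero hd0 ?_
  calc (max x 0) ^ s ≤ ((d ^ s⁻¹) ^ 2) ^ s :=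
        Real.rpow_le_rpow (le_max_right _ _) (max_le hx (by positivity)) hs.le
    _ = d ^ 2 := by
      rw [← Real.rpow_natCast, ← Real.rpow_mul hd0.le, ← Real.rpow_mul hd0.le, mul_right_comm,
        inv_mul_cancel₀ hs.ne', one_mul, Real.rpow_natCast]

lemma le_sNumber_opAbsPow (A : H →L[ℂ] H) {s : ℝ} (hs : 0 < s) (k : ℕ) :
    sNumber A k ^ s ≤ sNumber (opAbsPow A s) k := by
  refine le_of_forall_gt_imp_ge_of_dense fun d hd => ?_
  have hd0 : 0 < d := (sNumber_nonneg _ k).trans_lt hd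
  have hP : IsSelfAdjoint (star A * A) := .star_mul_self A
  have hpow : Continuous fun x : ℝ => x ^ s := Real.continuous_rpow_const hs.le
  have hc0 : 0 < d ^ s⁻¹ := by positivity
  have hsoft := continuous_softThreshold hc0
  have hcont : Continuous fun x : ℝ => softThreshold (d ^ s⁻¹) ((max x 0) ^ s⁻¹) :=
    hsoft.comp ((Real.continuous_rpow_const (by positivity : 0 ≤ s⁻¹)).comp
      (by fun_prop : Continuous fun x : ℝ => max x 0))
  rw [← Real.le_rpow_inv_iff_of_pos (sNumber_nonneg A k) hd0.le hs]
  refine sNumber_le_of_rank_range_cfc_le hc0 ?_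
  have h1 := rank_range_cfc_le_of_sNumber_lt hcont hd fun x hx => by
    refine softThreshold_eq_zero hc0 ?_
    calc (max x 0) ^ s⁻¹ ≤ (d ^ 2) ^ s⁻¹ :=
          Real.rpow_le_rpow (le_max_right _ _) (max_le hx (by positivity)) (by positivity)
      _ = (d ^ s⁻¹) ^ 2 := by
        rw [← Real.rpow_natCast, ← Real.rpow_natCast, ← Real.rpow_mul hd0.le,
          ← Real.rpow_mul hd0.le, mul_comm]
  rw [star_opAbsPow_mul_self A hs, ← cfc_comp' _ (fun x : ℝ => x ^ s) (star A * A)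
    hcont.continuousOn hpow.continuousOn hP] at h1
  have heq : cfc (fun x : ℝ => softThreshold (d ^ s⁻¹) ((max (x ^ s) 0) ^ s⁻¹)) (star A * A) =
      cfc (softThreshold (d ^ s⁻¹)) (star A * A) :=
    cfc_congr fun x hx => by
      have hx0 := nonneg_of_mem_spectrum_star_mul_self A hx
      rw [max_eq_left (Real.rpow_nonneg hx0 s), Real.rpow_rpow_inv hx0 hs.ne']
  rwa [heq] at h1

/-- The singular numbers of `|A|^s` are the `s`-th powers of those of `A`. -/
lemma sNumber_opAbsPow (A : H →L[ℂ] H) {s : ℝ} (hs : 0 < s) (k : ℕ) :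
    sNumber (opAbsPow A s) k = sNumber A k ^ s :=
  (sNumber_opAbsPow_le A hs k).antisymm (le_sNumber_opAbsPow A hs k)

end FunctionalCalculus

/-! ### The Ky Fan inequality -/

section KyFan

variable {H : Type*} [NormedAddCommGroup H] [InnerProductSpace ℂ H]

open scoped InnerProductSpace

lemma exists_threshold_of_antitone {a : ℕ → ℝ} (ha : Antitone a) (c : ℝ) (n : ℕ) :
    ∃ m ≤ n, (∀ k < m, c ≤ a k) ∧ ∀ k, m ≤ k → k < n → a k < c := by
  induction n with
  | zero => exact ⟨0, le_rfl, by simp, by simp⟩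
  | succ n ih =>
    obtain ⟨m, hmn, h1, h2⟩ := ih
    by_cases hc : c ≤ a n
    · exact ⟨n + 1, le_rfl, fun k hk => hc.trans (ha (Nat.lt_succ_iff.mp hk)),
        fun k hk hk' => absurd hk (not_le.mpr hk')⟩
    · refine ⟨m, hmn.trans n.le_succ, h1, fun k hk hk' => ?_⟩
      rcases (Nat.lt_succ_iff.mp hk').lt_or_eq with h | rfl
      · exact h2 k hk h
      · exact not_le.mp hc

/-- Greedy choice of an orthonormal system with the `k`-th vector in `V k`. -/
lemma exists_orthonormal_mem {m : ℕ} {V : ℕ → Submodule ℂ H}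
    (hV : ∀ k < m, ∀ G : H →ₗ[ℂ] (Fin k → ℂ), ∃ x ∈ V k, x ≠ 0 ∧ G x = 0) :
    ∃ u : Fin m → H, Orthonormal ℂ u ∧ ∀ i : Fin m, u i ∈ V i := by
  suffices h : ∃ u : ℕ → H, (∀ i < m, u i ∈ V i ∧ ‖u i‖ = 1) ∧
      ∀ j < m, ∀ i < j, ⟪u i, u j⟫_ℂ = 0 by
    obtain ⟨u, h1, h2⟩ := h
    refine ⟨fun i => u i, ⟨fun i => (h1 i i.2).2, fun i j hij => ?_⟩, fun i => (h1 i i.2).1⟩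
    rcases lt_or_gt_of_ne (Fin.val_ne_of_ne hij) with h | h
    · exact h2 j j.2 i h
    · exact inner_eq_zero_symm.mp (h2 i i.2 j h)
  induction m with
  | zero => exact ⟨0, by simp, by simp⟩
  | succ m ih =>
    obtain ⟨u, h1, h2⟩ := ih fun k hk => hV k (hk.trans m.lt_succ_self)
    obtain ⟨x, hxV, hx0, hGx⟩ := hV m m.lt_succ_self
      (LinearMap.pi fun i : Fin m => (innerSL ℂ (u i) : H →ₗ[ℂ] ℂ))
    have hGx' : ∀ i < m, ⟪u i, x⟫_ℂ = 0 := fun i hi => by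
      simpa using congrFun hGx ⟨i, hi⟩
    have hx : ‖x‖ ≠ 0 := norm_ne_zero_iff.mpr hx0
    refine ⟨Function.update u m (((‖x‖⁻¹ : ℝ) : ℂ) • x), fun i hi => ?_, fun j hj i hij => ?_⟩
    · rcases (Nat.lt_succ_iff.mp hi).lt_or_eq with h | rfl
      · rw [Function.update_of_ne h.ne]
        exact h1 i h
      · rw [Function.update_self]
        refine ⟨Submodule.smul_mem _ _ hxV, ?_⟩
        rw [norm_smul, Complex.norm_real, norm_inv, norm_norm, inv_mul_cancel₀ hx]
    · rcases (Nat.lt_succ_iff.mp hj).lt_or_eq with h | rfl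
      · rw [Function.update_of_ne h.ne, Function.update_of_ne (hij.trans h).ne]
        exact h2 j h i hij
      · rw [Function.update_self, Function.update_of_ne hij.ne, inner_smul_right, hGx' i hij,
          mul_zero]

lemma sum_inner_apply_eq_of_mem_span {m : ℕ} {u b : Fin m → H} (hu : Orthonormal ℂ u)
    (hb : Orthonormal ℂ b) (hbu : ∀ i, b i ∈ Submodule.span ℂ (Set.range u)) (A : H →L[ℂ] H) :
    ∑ i, ⟪u i, A (u i)⟫_ℂ = ∑ i, ⟪b i, A (b i)⟫_ℂ := by
  set V := Submodule.span ℂ (Set.range u) with hV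
  have hfin : FiniteDimensional ℂ V := FiniteDimensional.span_of_finite ℂ (Set.finite_range u)
  have hrank : Module.finrank ℂ V = Fintype.card (Fin m) :=
    finrank_span_eq_card hu.linearIndependent
  let T : V →ₗ[ℂ] V :=
    (V.orthogonalProjectionOnto : H →ₗ[ℂ] V) ∘ₗ (A : H →ₗ[ℂ] H) ∘ₗ V.subtype
  have key : ∀ v : Fin m → H, Orthonormal ℂ v → (∀ i, v i ∈ V) →
      LinearMap.trace ℂ V T = ∑ i, ⟪v i, A (v i)⟫_ℂ := by
    intro v hv hvV
    let w : Fin m → V := fun i => ⟨v i, hvV i⟩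
    have hw : Orthonormal ℂ w := by
      refine ⟨fun i => hv.1 i, fun i j hij => ?_⟩
      exact hv.2 hij
    have hspan : ⊤ ≤ Submodule.span ℂ (Set.range w) := by
      rw [hw.linearIndependent.span_eq_top_of_card_eq_finrank' hrank.symm]
    rw [LinearMap.trace_eq_sum_inner T (OrthonormalBasis.mk hw hspan)]
    refine Finset.sum_congr rfl fun i _ => ?_
    simp only [OrthonormalBasis.coe_mk]
    simp [T, w]
  rw [← key u hu fun i => Submodule.subset_span ⟨i, rfl⟩, key b hb hbu]

lemma rank_range_prod_le {F : H →ₗ[ℂ] H} {j k : ℕ}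
    (hF : Module.rank ℂ (LinearMap.range F) ≤ j) (G : H →ₗ[ℂ] (Fin k → ℂ)) :
    Module.rank ℂ (LinearMap.range (F.prod G)) ≤ (j + k : ℕ) := by
  have h0 : F.prod G = LinearMap.inl ℂ H (Fin k → ℂ) ∘ₗ F + LinearMap.inr ℂ H (Fin k → ℂ) ∘ₗ G := by
    ext x <;> simp
  have h1 : LinearMap.rank (LinearMap.inl ℂ H (Fin k → ℂ) ∘ₗ F) ≤ j :=
    (LinearMap.rank_comp_le_right F _).trans hF
  have h2 : LinearMap.rank (LinearMap.inr ℂ H (Fin k → ℂ) ∘ₗ G) ≤ k := by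
    have h3 := LinearMap.lift_rank_comp_le_right G (LinearMap.inr ℂ H (Fin k → ℂ))
    have h4 : LinearMap.rank G ≤ k := by simpa using LinearMap.rank_le_range G
    have h5 := (Cardinal.lift_le_nat_iff.mpr h4)
    exact Cardinal.lift_le_nat_iff.mp (h3.trans h5)
  rw [h0]
  push_cast
  exact (LinearMap.rank_add_le _ _).trans (add_le_add h1 h2)

lemma sum_re_inner_le_sum_sNumber (A : H →L[ℂ] H) {m : ℕ} {u : Fin m → H}
    (hu : Orthonormal ℂ u) :
    ∑ i, (⟪u i, A (u i)⟫_ℂ).re ≤ ∑ k ∈ Finset.range m, sNumber A k := by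
  have hε : ∀ ε > 0, ∑ i, (⟪u i, A (u i)⟫_ℂ).re ≤
      ∑ k ∈ Finset.range m, sNumber A k + m * ε := by
    intro ε hε
    choose F hF hAF using fun k => exists_norm_sub_lt_of_sNumber_lt
      (lt_add_of_pos_right (sNumber A k) hε)
    set V := Submodule.span ℂ (Set.range u) with hV
    have hrank : Module.rank ℂ V = m := by
      have hfin : FiniteDimensional ℂ V :=
        FiniteDimensional.span_of_finite ℂ (Set.finite_range u)
      rw [← Module.finrank_eq_rank, hV, finrank_span_eq_card hu.linearIndependent,
        Fintype.card_fin]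
    obtain ⟨b, hb, hbV⟩ := exists_orthonormal_mem (m := m)
      (V := fun k => V ⊓ LinearMap.ker (F (m - 1 - k) : H →ₗ[ℂ] H)) (fun k hk G => by
        have hlt : ((m - 1 - k + k : ℕ) : Cardinal) < Module.rank ℂ V := by
          rw [hrank]
          exact_mod_cast (by omega : m - 1 - k + k < m)
        obtain ⟨x, hx, hx0, hFG⟩ :=
          exists_mem_ker_of_rank_lt (rank_range_prod_le (hF (m - 1 - k)) G) hlt
        rw [LinearMap.prod_apply, Function.prod_apply, Prod.mk_eq_zero] at hFG
        exact ⟨x, ⟨hx, hFG.1⟩, hx0, hFG.2⟩)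
    have h1 := sum_inner_apply_eq_of_mem_span hu hb (fun i => (hbV i).1) A
    have h2 : ∀ i : Fin m, (⟪b i, A (b i)⟫_ℂ).re ≤ sNumber A (m - 1 - i) + ε := fun i => by
      have hFb : F (m - 1 - i) (b i) = 0 := (hbV i).2
      calc (⟪b i, A (b i)⟫_ℂ).re ≤ ‖⟪b i, A (b i)⟫_ℂ‖ := Complex.re_le_norm _
        _ ≤ ‖b i‖ * ‖A (b i)‖ := norm_inner_le_norm _ _
        _ = ‖(A - F (m - 1 - i)) (b i)‖ := by simp [hb.1 i, hFb]
        _ ≤ ‖A - F (m - 1 - i)‖ * ‖b i‖ := ContinuousLinearMap.le_opNorm _ _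
        _ ≤ _ := by rw [hb.1 i, mul_one]; exact (hAF _).le
    calc ∑ i, (⟪u i, A (u i)⟫_ℂ).re = ∑ i, (⟪b i, A (b i)⟫_ℂ).re := by
          rw [← Complex.re_sum, h1, Complex.re_sum]
      _ ≤ ∑ i : Fin m, (sNumber A (m - 1 - i) + ε) := Finset.sum_le_sum fun i _ => h2 i
      _ = ∑ k ∈ Finset.range m, (sNumber A (m - 1 - k) + ε) :=
          Fin.sum_univ_eq_sum_range (fun k => sNumber A (m - 1 - k) + ε) m
      _ = _ := by
          rw [Finset.sum_add_distrib, Finset.sum_range_reflect]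
          simp
  refine le_of_forall_pos_le_add fun ε hpos => (hε (ε / (m + 1)) (by positivity)).trans ?_
  gcongr
  rw [mul_div_assoc', div_le_iff₀ (by positivity)]
  nlinarith

variable [CompleteSpace H]

lemma exists_orthonormal_sum_sNumber_le (A : H →L[ℂ] H) (n : ℕ) {δ : ℝ} (hδ : 0 < δ) :
    ∃ m ≤ n, ∃ u : Fin m → H, Orthonormal ℂ u ∧ ∃ W : H →L[ℂ] H, ‖W‖ ≤ 1 ∧
      ∑ k ∈ Finset.range n, sNumber A k ≤ ∑ i, (⟪u i, (W * A) (u i)⟫_ℂ).re + n * (2 * δ) := by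
  obtain ⟨m, hmn, hlarge, hsmall⟩ :=
    exists_threshold_of_antitone (sNumber_antitone A) (2 * δ) n
  have hP : IsSelfAdjoint (star A * A) := .star_mul_self A
  have hcpos : ∀ k < m, δ ≤ sNumber A k - δ := fun k hk => by linarith [hlarge k hk]
  obtain ⟨u, hu, huV⟩ := exists_orthonormal_mem (m := m)
    (V := fun k => LinearMap.range
      ((cfc (softThreshold (sNumber A k - δ)) (star A * A) : H →L[ℂ] H) : H →ₗ[ℂ] H))
    (fun k hk G => by
      refine exists_mem_ker_of_rank_lt (k := k) (by simpa using LinearMap.rank_le_range G) ?_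
      by_contra! hle
      have := sNumber_le_of_rank_range_cfc_le (hδ.trans_le (hcpos k hk)) hle
      linarith)
  set q : ℝ → ℝ := fun x => δ / max δ (√x) with hq
  have hcont : Continuous q :=
    continuous_const.div (by fun_prop) fun x => (lt_max_of_lt_left hδ).ne'
  have hsa : IsSelfAdjoint (cfc q (star A * A)) := cfc_predicate q _
  refine ⟨m, hmn, u, hu, δ⁻¹ • star (A * cfc q (star A * A)), ?_, ?_⟩
  · rw [norm_smul, norm_star, norm_inv, Real.norm_of_nonneg hδ.le, inv_mul_le_iff₀ hδ, mul_one]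
    exact norm_mul_cfc_div_max_le A hδ
  have hWA : δ⁻¹ • star (A * cfc q (star A * A)) * A =
      cfc (fun x => δ⁻¹ * (q x * x)) (star A * A) := by
    rw [cfc_const_mul δ⁻¹ (fun x => q x * x) (star A * A)
      (hcont.mul continuous_id).continuousOn, cfc_mul q (fun x => x) (star A * A)
      hcont.continuousOn continuousOn_id, cfc_id' ℝ (star A * A), star_mul, hsa.star_eq,
      smul_mul_assoc, mul_assoc]
  rw [hWA]
  have hterm : ∀ i : Fin m, sNumber A i - δ ≤
      (⟪u i, cfc (fun x => δ⁻¹ * (q x * x)) (star A * A) (u i)⟫_ℂ).re := fun i => by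
    obtain ⟨y, hy⟩ := huV i
    have hc := hδ.trans_le (hcpos i i.2)
    have h1 := mul_norm_sq_le_re_inner_cfc hP (g := fun x => δ⁻¹ * (q x * x))
      (continuous_const.mul (hcont.mul continuous_id)) (continuous_softThreshold hc)
      (κ := sNumber A i - δ) (fun x hx hne => by
        have hx0 := nonneg_of_mem_spectrum_star_mul_self A hx
        have hcx : (sNumber A i - δ) ^ 2 < x :=
          not_le.mp fun hle => hne (softThreshold_eq_zero hc hle)
        have hsq : sNumber A i - δ ≤ √x := Real.le_sqrt_of_sq_le hcx.le
        have hxpos : 0 < √x := hc.trans_le hsq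
        have hmax : max δ (√x) = √x := max_eq_right ((hcpos i i.2).trans hsq)
        simp only [hq, hmax]
        have : δ⁻¹ * (δ / √x * x) = √x := by
          field_simp
          exact (Real.sq_sqrt hx0).symm
        rw [this]
        exact hsq) y
    rw [show cfc (softThreshold (sNumber A i - δ)) (star A * A) y = u i from hy, hu.1 i] at h1
    rw [← inner_conj_symm, Complex.conj_re]
    simpa using h1
  have hsplit : ∑ k ∈ Finset.range n, sNumber A k ≤
      ∑ k ∈ Finset.range n, ((if k < m then sNumber A k - δ else 0) + 2 * δ) := by
    refine Finset.sum_le_sum fun k hk => ?_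
    split_ifs with h
    · linarith
    · linarith [hsmall k (not_lt.mp h) (Finset.mem_range.mp hk)]
  have hfilter : ∑ k ∈ Finset.range n, (if k < m then sNumber A k - δ else 0) =
      ∑ i : Fin m, (sNumber A i - δ) := by
    rw [Fin.sum_univ_eq_sum_range (fun k => sNumber A k - δ) m, ← Finset.sum_filter]
    congr 1
    ext k
    simp only [Finset.mem_filter, Finset.mem_range]
    omega
  rw [Finset.sum_add_distrib, hfilter] at hsplit
  refine hsplit.trans ?_
  simp only [Finset.sum_const, Finset.card_range, nsmul_eq_mul]
  gcongr with i
  exact hterm i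

/-- The Ky Fan triangle inequality for approximation numbers. -/
lemma sum_sNumber_sum_le {ι : Type*} (J : Finset ι) (A : ι → H →L[ℂ] H) (n : ℕ) :
    ∑ k ∈ Finset.range n, sNumber (∑ j ∈ J, A j) k ≤
      ∑ j ∈ J, ∑ k ∈ Finset.range n, sNumber (A j) k := by
  have hδ : ∀ δ > 0, ∑ k ∈ Finset.range n, sNumber (∑ j ∈ J, A j) k ≤
      ∑ j ∈ J, ∑ k ∈ Finset.range n, sNumber (A j) k + n * (2 * δ) := by
    intro δ hδ
    obtain ⟨m, hmn, u, hu, W, hW, h⟩ :=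
      exists_orthonormal_sum_sNumber_le (∑ j ∈ J, A j) n hδ
    refine h.trans ?_
    gcongr
    calc ∑ i, (⟪u i, (W * ∑ j ∈ J, A j) (u i)⟫_ℂ).re
        = ∑ j ∈ J, ∑ i, (⟪u i, (W * A j) (u i)⟫_ℂ).re := by
          rw [Finset.sum_comm]
          refine Finset.sum_congr rfl fun i _ => ?_
          rw [Finset.mul_sum, sum_apply, inner_sum, Complex.re_sum]
      _ ≤ ∑ j ∈ J, ∑ k ∈ Finset.range m, sNumber (W * A j) k :=
          Finset.sum_le_sum fun j _ => sum_re_inner_le_sum_sNumber (W * A j) hu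
      _ ≤ ∑ j ∈ J, ∑ k ∈ Finset.range m, sNumber (A j) k :=
          Finset.sum_le_sum fun j _ => Finset.sum_le_sum fun k _ => sNumber_mul_le_right hW _ k
      _ ≤ _ := Finset.sum_le_sum fun j _ => Finset.sum_le_sum_of_subset_of_nonneg
          (Finset.range_subset_range.mpr hmn) fun k _ _ => sNumber_nonneg _ k
  refine le_of_forall_pos_le_add fun ε hpos => (hδ (ε / (2 * (n + 1))) (by positivity)).trans ?_
  gcongr
  rw [mul_div_assoc', mul_div_assoc', div_le_iff₀ (by positivity)]
  nlinarith

end KyFan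

/-! ### Sums of powers of approximation numbers -/

section PowerSums

lemma min_mul_rpow_of_le {t x s : ℝ} (hx : 0 < x) (hxt : x ≤ t) :
    min t x * x ^ (s - 2) = x ^ (s - 1) := by
  rw [min_eq_right hxt, mul_comm, ← Real.rpow_add_one hx.ne']
  congr 1
  ring

lemma integrableOn_min_mul_rpow_and_integral {s t : ℝ} (hs : 0 < s) (hs1 : s < 1) (ht : 0 ≤ t) :
    IntegrableOn (fun x => min t x * x ^ (s - 2)) (Set.Ioi 0) ∧
      ∫ x in Set.Ioi 0, min t x * x ^ (s - 2) = (1 / s + 1 / (1 - s)) * t ^ s := by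
  rcases ht.eq_or_lt with rfl | ht
  · have h0 : Set.EqOn (fun x : ℝ => min 0 x * x ^ (s - 2)) (fun _ => 0) (Set.Ioi 0) :=
      fun x hx => by simp [min_eq_left (Set.mem_Ioi.mp hx).le]
    refine ⟨(integrableOn_congr_fun h0 measurableSet_Ioi).mpr integrableOn_zero, ?_⟩
    rw [setIntegral_congr_fun measurableSet_Ioi h0]
    simp [Real.zero_rpow hs.ne']
  have e1 : Set.EqOn (fun x : ℝ => min t x * x ^ (s - 2)) (fun x => x ^ (s - 1)) (Set.Ioc 0 t) :=
    fun x hx => min_mul_rpow_of_le hx.1 hx.2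
  have e2 : Set.EqOn (fun x : ℝ => min t x * x ^ (s - 2)) (fun x => t * x ^ (s - 2))
      (Set.Ioi t) := fun x hx => by simp [min_eq_left (Set.mem_Ioi.mp hx).le]
  have i1 : IntegrableOn (fun x : ℝ => min t x * x ^ (s - 2)) (Set.Ioc 0 t) := by
    rw [integrableOn_congr_fun e1 measurableSet_Ioc,
      ← intervalIntegrable_iff_integrableOn_Ioc_of_le ht.le]
    exact intervalIntegral.intervalIntegrable_rpow' (by linarith)
  have i2 : IntegrableOn (fun x : ℝ => min t x * x ^ (s - 2)) (Set.Ioi t) := by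
    rw [integrableOn_congr_fun e2 measurableSet_Ioi]
    exact (integrableOn_Ioi_rpow_of_lt (by linarith) ht).const_mul t
  rw [← Set.Ioc_union_Ioi_eq_Ioi ht.le]
  refine ⟨i1.union i2, ?_⟩
  rw [setIntegral_union (Set.Ioc_disjoint_Ioi le_rfl) measurableSet_Ioi i1 i2,
    setIntegral_congr_fun measurableSet_Ioc e1, setIntegral_congr_fun measurableSet_Ioi e2,
    ← intervalIntegral.integral_of_le ht.le, integral_rpow (Or.inl (by linarith)),
    integral_const_mul, integral_Ioi_rpow_of_lt (by linarith) ht]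
  have h1 : s - 1 + 1 = s := by ring
  have h2 : s - 2 + 1 = s - 1 := by ring
  have h3 : t ^ (s - 1) = t ^ s / t := Real.rpow_sub_one ht.ne' s
  have h4 : s - 1 ≠ 0 := by linarith
  have h5 : 1 - s ≠ 0 := by linarith
  rw [h1, h2, h3, Real.zero_rpow hs.ne', ← neg_sub 1 s]
  field_simp
  ring

/-- Comparison of sums of truncations at all levels implies comparison of sums of powers. -/
lemma sum_rpow_le_of_sum_min_le {ι κ : Type*} {K : Finset κ} {I : Finset ι} {a : κ → ℝ}
    {b : ι → ℝ} (ha : ∀ k ∈ K, 0 ≤ a k) (hb : ∀ i ∈ I, 0 ≤ b i) {C : ℝ}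
    (h : ∀ t > 0, ∑ k ∈ K, min (a k) t ≤ C * ∑ i ∈ I, min (b i) t) {s : ℝ} (hs : 0 < s)
    (hs1 : s < 1) : ∑ k ∈ K, a k ^ s ≤ C * ∑ i ∈ I, b i ^ s := by
  have hc : 0 < 1 / s + 1 / (1 - s) := by
    have : 0 < 1 - s := by linarith
    positivity
  have ia := fun k hk => integrableOn_min_mul_rpow_and_integral hs hs1 (ha k hk)
  have ib := fun i hi => integrableOn_min_mul_rpow_and_integral hs hs1 (hb i hi)
  have key : ∫ x in Set.Ioi 0, ∑ k ∈ K, min (a k) x * x ^ (s - 2) ≤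
      ∫ x in Set.Ioi 0, C * ∑ i ∈ I, min (b i) x * x ^ (s - 2) := by
    refine setIntegral_mono_on (integrable_finsetSum _ fun k hk => (ia k hk).1)
      ((integrable_finsetSum _ fun i hi => (ib i hi).1).const_mul C) measurableSet_Ioi
      fun x hx => ?_
    rw [← Finset.sum_mul, ← Finset.sum_mul, ← mul_assoc]
    exact mul_le_mul_of_nonneg_right (h x hx) (Real.rpow_nonneg (Set.mem_Ioi.mp hx).le _)
  rw [integral_const_mul, integral_finsetSum _ fun k hk => (ia k hk).1,
    integral_finsetSum _ fun i hi => (ib i hi).1, Finset.sum_congr rfl fun k hk => (ia k hk).2,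
    Finset.sum_congr rfl fun i hi => (ib i hi).2, ← Finset.mul_sum, ← Finset.mul_sum,
    mul_left_comm] at key
  exact le_of_mul_le_mul_left key hc

variable {H : Type*} [NormedAddCommGroup H] [InnerProductSpace ℂ H]

lemma rank_range_sum_le {ι : Type*} (J : Finset ι) {R : ι → H →L[ℂ] H} {r : ι → ℕ}
    (hR : ∀ j ∈ J, Module.rank ℂ (LinearMap.range (R j : H →ₗ[ℂ] H)) ≤ r j) :
    Module.rank ℂ (LinearMap.range ((∑ j ∈ J, R j : H →L[ℂ] H) : H →ₗ[ℂ] H)) ≤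
      (∑ j ∈ J, r j : ℕ) := by
  classical
  induction J using Finset.induction_on with
  | empty =>
    rw [Finset.sum_empty, Finset.sum_empty]
    exact rank_range_zero_le 0
  | insert j J hj ih =>
    rw [Finset.sum_insert hj, Finset.sum_insert hj, ContinuousLinearMap.toLinearMap_add]
    push_cast
    refine (LinearMap.rank_add_le _ _).trans (add_le_add (hR j (Finset.mem_insert_self j J)) ?_)
    exact_mod_cast ih fun i hi => hR i (Finset.mem_insert_of_mem hi)

variable [CompleteSpace H]

lemma sum_min_sNumber_sum_le {ι : Type*} (J : Finset ι) (A : ι → H →L[ℂ] H) (n : ℕ) {t : ℝ}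
    (ht : 0 < t) :
    ∑ k ∈ Finset.range n, min (sNumber (∑ j ∈ J, A j) k) t ≤
      2 * ∑ j ∈ J, ∑ k ∈ Finset.range n, min (sNumber (A j) k) t := by
  have hnn : ∀ j k, 0 ≤ min (sNumber (A j) k) t := fun j k => le_min (sNumber_nonneg _ k) ht.le
  have hnn' : ∀ j, 0 ≤ ∑ k ∈ Finset.range n, min (sNumber (A j) k) t :=
    fun j => Finset.sum_nonneg fun k _ => hnn j k
  choose r hrn hlarge hsmall using fun j =>
    exists_threshold_of_antitone (sNumber_antitone (A j)) t n
  have hr : ∀ j, r j * t ≤ ∑ k ∈ Finset.range n, min (sNumber (A j) k) t := fun j => by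
    calc r j * t = ∑ k ∈ Finset.range (r j), min (sNumber (A j) k) t := by
          rw [Finset.sum_congr rfl fun k hk =>
            min_eq_right (hlarge j k (Finset.mem_range.mp hk))]
          simp
      _ ≤ _ := Finset.sum_le_sum_of_subset_of_nonneg
          (Finset.range_subset_range.mpr (hrn j)) fun k _ _ => hnn j k
  by_cases hfull : ∃ j ∈ J, r j = n
  · obtain ⟨j, hj, hjn⟩ := hfull
    have h1 : ∑ k ∈ Finset.range n, min (sNumber (∑ j ∈ J, A j) k) t ≤ n * t := by
      refine (Finset.sum_le_sum fun k _ => min_le_right _ t).trans ?_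
      simp
    have h2 := hr j
    rw [hjn] at h2
    have h3 := Finset.single_le_sum (f := fun j => ∑ k ∈ Finset.range n, min (sNumber (A j) k) t)
      (fun i _ => hnn' i) hj
    linarith [Finset.sum_nonneg fun j (_ : j ∈ J) => hnn' j]
  push Not at hfull
  have hex : ∀ j, ∃ R : H →L[ℂ] H, j ∈ J →
      Module.rank ℂ (LinearMap.range (R : H →ₗ[ℂ] H)) ≤ r j ∧
      ∀ k, sNumber (A j - R) k ≤ min (sNumber (A j) k) t := fun j => by
    by_cases hj : j ∈ J
    · obtain ⟨R, hR⟩ := exists_rank_le_sNumber_sub_le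
        (hsmall j (r j) le_rfl (lt_of_le_of_ne (hrn j) (hfull j hj)))
      exact ⟨R, fun _ => hR⟩
    · exact ⟨0, fun h => absurd h hj⟩
  choose R hR using hex
  have hrank := rank_range_sum_le J fun j hj => (hR j hj).1
  set S := ∑ j ∈ J, A j with hS
  set ρ := ∑ j ∈ J, r j with hρ
  calc ∑ k ∈ Finset.range n, min (sNumber S k) t
      ≤ ∑ k ∈ Finset.range (ρ + n), min (sNumber S k) t :=
        Finset.sum_le_sum_of_subset_of_nonneg (Finset.range_subset_range.mpr (by omega))
          fun k _ _ => le_min (sNumber_nonneg _ k) ht.le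
    _ = ∑ k ∈ Finset.range ρ, min (sNumber S k) t +
        ∑ k ∈ Finset.range n, min (sNumber S (ρ + k)) t := Finset.sum_range_add _ _ _
    _ ≤ ∑ k ∈ Finset.range ρ, t + ∑ k ∈ Finset.range n, sNumber (S - ∑ j ∈ J, R j) k := by
        gcongr with k _ k _
        · exact min_le_right _ _
        · rw [add_comm ρ k]
          exact (min_le_left _ _).trans (sNumber_add_rank_le hrank k)
    _ = ∑ j ∈ J, r j * t +
        ∑ k ∈ Finset.range n, sNumber (∑ j ∈ J, (A j - R j)) k := by
        rw [Finset.sum_sub_distrib, Finset.sum_const, Finset.card_range, nsmul_eq_mul, hρ,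
          Nat.cast_sum, Finset.sum_mul]
    _ ≤ ∑ j ∈ J, ∑ k ∈ Finset.range n, min (sNumber (A j) k) t +
        ∑ j ∈ J, ∑ k ∈ Finset.range n, sNumber (A j - R j) k :=
        add_le_add (Finset.sum_le_sum fun j _ => hr j) (sum_sNumber_sum_le J _ n)
    _ ≤ _ := by
        rw [two_mul]
        gcongr with j hj k _
        exact (hR j hj).2 k

/-- A Rotfeld type inequality: sums of the `s`-th powers of the first `n` approximation numbers
are subadditive up to a factor `2`. -/
lemma sum_sNumber_rpow_sum_le {ι : Type*} (J : Finset ι) (A : ι → H →L[ℂ] H) (n : ℕ) {s : ℝ}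
    (hs : 0 < s) (hs1 : s ≤ 1) :
    ∑ k ∈ Finset.range n, sNumber (∑ j ∈ J, A j) k ^ s ≤
      2 * ∑ j ∈ J, ∑ k ∈ Finset.range n, sNumber (A j) k ^ s := by
  rcases hs1.eq_or_lt with rfl | hs1
  · simp only [Real.rpow_one]
    have h0 : 0 ≤ ∑ j ∈ J, ∑ k ∈ Finset.range n, sNumber (A j) k :=
      Finset.sum_nonneg fun j _ => Finset.sum_nonneg fun k _ => sNumber_nonneg _ k
    linarith [sum_sNumber_sum_le J A n]
  · have h := sum_rpow_le_of_sum_min_le (K := Finset.range n) (I := J ×ˢ Finset.range n)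
      (a := fun k => sNumber (∑ j ∈ J, A j) k) (b := fun p => sNumber (A p.1) p.2) (C := 2)
      (fun k _ => sNumber_nonneg _ k) (fun p _ => sNumber_nonneg _ _)
      (fun t ht => by
        rw [Finset.sum_product]
        exact sum_min_sNumber_sum_le J A n ht) hs hs1
    rwa [Finset.sum_product] at h

end PowerSums

/-! ### Symmetric norming functions and weak majorization -/

namespace SymmNormingFun

variable (Φ : SymmNormingFun)

lemma finSupp_truncation (m : ℕ) (x : ℕ → ℝ) : FinSupp fun j => if j < m then x j else 0 :=
  (Set.finite_lt_nat m).subset fun j hj => by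
    by_contra h
    exact hj (if_neg h)

/-- The value of a symmetric norming function on the first `m` terms of a sequence. -/
def onTrunc (m : ℕ) (x : ℕ → ℝ) : ℝ := Φ.toFun fun j => if j < m then x j else 0

lemma onTrunc_nonneg (m : ℕ) (x : ℕ → ℝ) : 0 ≤ Φ.onTrunc m x :=
  Φ.nonneg _ (finSupp_truncation m x)

lemma onTrunc_add_le (m : ℕ) (x y : ℕ → ℝ) :
    Φ.onTrunc m (x + y) ≤ Φ.onTrunc m x + Φ.onTrunc m y := by
  have h := Φ.add_le _ _ (finSupp_truncation m x) (finSupp_truncation m y)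
  have e : ((fun j => if j < m then x j else 0) + fun j => if j < m then y j else 0) =
      fun j => if j < m then (x + y) j else 0 := by
    ext j
    by_cases hj : j < m <;> simp [hj]
  rwa [e] at h

lemma onTrunc_smul (m : ℕ) (c : ℝ) (x : ℕ → ℝ) : Φ.onTrunc m (c • x) = |c| * Φ.onTrunc m x := by
  have h := Φ.smul_eq c _ (finSupp_truncation m x)
  have e : (c • fun j => if j < m then x j else 0) = fun j => if j < m then (c • x) j else 0 := by
    ext j
    by_cases hj : j < m <;> simp [hj]
  rwa [e] at h

lemma onTrunc_zero (m : ℕ) : Φ.onTrunc m 0 = 0 := by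
  simpa using Φ.onTrunc_smul m 0 0

lemma onTrunc_sum_le (m : ℕ) {ι : Type*} (J : Finset ι) (x : ι → ℕ → ℝ) :
    Φ.onTrunc m (∑ j ∈ J, x j) ≤ ∑ j ∈ J, Φ.onTrunc m (x j) :=
  Finset.le_sum_of_subadditive _ (Φ.onTrunc_zero m).le (Φ.onTrunc_add_le m) J x

lemma ofReal_onTrunc_le_ext (m : ℕ) (x : ℕ → ℝ) : ENNReal.ofReal (Φ.onTrunc m x) ≤ Φ.ext x :=
  le_iSup (fun m : ℕ => ENNReal.ofReal (Φ.onTrunc m x)) m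

lemma toFun_single_s13 (k : ℕ) (c : ℝ) : Φ.toFun (fun j => if j = k then c else 0) = |c| := by
  have hfin : ∀ i, FinSupp fun j => if j = i then (1 : ℝ) else 0 := fun i =>
    (Set.finite_singleton i).subset fun j hj => by
      by_contra h
      exact hj (if_neg h)
  have h1 : Φ.toFun (fun j => if j = k then (1 : ℝ) else 0) = 1 := by
    rw [Φ.symm (Equiv.swap 0 k) _ (hfin k)]
    refine Eq.trans ?_ Φ.normalized
    congr 1
    ext j
    have : Equiv.swap 0 k j = k ↔ j = 0 := by
      rw [Equiv.swap_apply_eq_iff, Equiv.swap_apply_right]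
    by_cases hj : j = 0 <;> simp [this, hj]
  have h2 := Φ.smul_eq c _ (hfin k)
  rw [h1, mul_one] at h2
  rw [← h2]
  congr 1
  ext j
  simp

lemma onTrunc_one (x : ℕ → ℝ) : Φ.onTrunc 1 x = |x 0| := by
  rw [← Φ.toFun_single_s13 0 (x 0), onTrunc]
  congr 1
  ext j
  rcases j with _ | j <;> simp

lemma onTrunc_le_sum_abs (m : ℕ) (x : ℕ → ℝ) : Φ.onTrunc m x ≤ ∑ k ∈ Finset.range m, |x k| := by
  induction m with
  | zero =>
    have : Φ.onTrunc 0 x = Φ.onTrunc 0 0 := by simp [onTrunc]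
    simp [this, onTrunc_zero]
  | succ m ih =>
    rw [Finset.sum_range_succ, ← Φ.toFun_single_s13 m (x m)]
    refine le_trans ?_ (add_le_add_left ih _)
    have hfin : FinSupp fun j => if j = m then x m else 0 :=
      (Set.finite_singleton m).subset fun j hj => by
        by_contra h
        exact hj (if_neg h)
    refine le_trans (le_of_eq ?_) (Φ.add_le _ _ (finSupp_truncation m x) hfin)
    unfold onTrunc
    congr 1
    ext j
    rcases lt_trichotomy j m with h | rfl | h
    · simp [h, h.ne, h.trans m.lt_succ_self]
    · simp
    · simp [h.not_gt, h.ne', not_lt.mpr (Nat.succ_le_of_lt h)]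

/-- Invariance under permutations preserving the first `m` indices and under sign changes. -/
lemma onTrunc_eq_of_abs_eq {m : ℕ} {x y : ℕ → ℝ} (θ : Equiv.Perm ℕ)
    (hθ : ∀ k, θ k < m ↔ k < m) (h : ∀ k, |x k| = |y (θ k)|) :
    Φ.onTrunc m x = Φ.onTrunc m y := by
  unfold onTrunc
  rw [Φ.symm (Equiv.refl ℕ) _ (finSupp_truncation m x), Φ.symm θ _ (finSupp_truncation m y)]
  congr 1
  ext k
  by_cases hk : k < m <;> simp [hk, hθ, h]

/-- A supporting functional for the norm `Φ.onTrunc m` at `x`. -/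
lemma exists_dual (m : ℕ) (x : ℕ → ℝ) :
    ∃ φ : ℕ → ℝ, ∑ k ∈ Finset.range m, φ k * x k = Φ.onTrunc m x ∧
      ∀ y, ∑ k ∈ Finset.range m, φ k * y k ≤ Φ.onTrunc m y := by
  obtain ⟨f, hfx, hf⟩ : ∃ f : (ℕ → ℝ) →ₗ[ℝ] ℝ, f x = Φ.onTrunc m x ∧ ∀ y, f y ≤ Φ.onTrunc m y := by
    rcases eq_or_ne x 0 with rfl | hx
    · exact ⟨0, by simp [onTrunc_zero], fun y => Φ.onTrunc_nonneg m y⟩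
    obtain ⟨f, h1, h2⟩ := exists_extension_of_le_sublinear
      (LinearPMap.mkSpanSingleton (K := ℝ) x (Φ.onTrunc m x) hx) (Φ.onTrunc m)
      (fun c hc y => by rw [onTrunc_smul, abs_of_pos hc]) (Φ.onTrunc_add_le m) (by
        rintro ⟨y, hy⟩
        obtain ⟨c, rfl⟩ := Submodule.mem_span_singleton.mp hy
        rw [LinearPMap.mkSpanSingleton'_apply, onTrunc_smul, smul_eq_mul, RingHom.id_apply]
        exact mul_le_mul_of_nonneg_right (le_abs_self c) (Φ.onTrunc_nonneg m x))
    refine ⟨f, ?_, h2⟩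
    have h3 := h1 ⟨x, Submodule.mem_span_singleton_self x⟩
    have h4 := LinearPMap.mkSpanSingleton_apply ℝ ℝ (σ := RingHom.id ℝ) hx (Φ.onTrunc m x)
    exact h3.trans h4
  have hrep : ∀ y, f y = ∑ k ∈ Finset.range m, f (Pi.single k 1) * y k := fun y => by
    set z : ℕ → ℝ := y - ∑ k ∈ Finset.range m, y k • Pi.single k (1 : ℝ) with hz
    have hz0 : ∀ k < m, z k = 0 := fun k hk => by
      simp [hz, Finset.sum_apply, Pi.single_apply, hk]
    have hzN : ∀ c : ℝ, Φ.onTrunc m (c • z) = 0 := fun c => by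
      rw [← Φ.onTrunc_zero m]
      unfold onTrunc
      congr 1
      ext k
      by_cases hk : k < m <;> simp [hk, hz0]
    have h1 := hf z
    have h2 := hf (-z)
    have h3 := hzN 1
    have h4 := hzN (-1)
    rw [one_smul] at h3
    rw [neg_one_smul] at h4
    rw [map_neg] at h2
    have h5 : f z = 0 := by linarith
    rw [hz, map_sub, map_sum, sub_eq_zero] at h5
    rw [h5]
    exact Finset.sum_congr rfl fun k _ => by rw [map_smul, smul_eq_mul, mul_comm]
  exact ⟨fun k => f (Pi.single k 1), by rw [← hrep, hfx], fun y => by rw [← hrep]; exact hf y⟩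

end SymmNormingFun

lemma sum_mul_le_sum_mul_of_antitone {w x y : ℕ → ℝ} (hw : Antitone w) (hw0 : ∀ k, 0 ≤ w k)
    (h : ∀ n, ∑ k ∈ Finset.range n, x k ≤ ∑ k ∈ Finset.range n, y k) (m : ℕ) :
    ∑ k ∈ Finset.range m, w k * x k ≤ ∑ k ∈ Finset.range m, w k * y k := by
  suffices H : ∀ n, w n * (∑ k ∈ Finset.range n, y k - ∑ k ∈ Finset.range n, x k) ≤
      ∑ k ∈ Finset.range n, w k * y k - ∑ k ∈ Finset.range n, w k * x k by
    have h1 := mul_nonneg (hw0 m) (sub_nonneg.mpr (h m))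
    linarith [H m]
  intro n
  induction n with
  | zero => simp
  | succ n ih =>
    have h1 := mul_le_mul_of_nonneg_right (hw n.le_succ) (sub_nonneg.mpr (h (n + 1)))
    simp only [Finset.sum_range_succ] at h1 ⊢
    linarith

/-- Symmetric norming functions are monotone with respect to weak majorization. -/
lemma SymmNormingFun.onTrunc_le_of_sum_le (Φ : SymmNormingFun) {x y : ℕ → ℝ} (hx : Antitone x)
    (hx0 : ∀ k, 0 ≤ x k)
    (h : ∀ n, ∑ k ∈ Finset.range n, x k ≤ ∑ k ∈ Finset.range n, y k) (m : ℕ) :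
    Φ.onTrunc m x ≤ Φ.onTrunc m y := by
  obtain ⟨φ, hφx, hφ⟩ := Φ.exists_dual m x
  let σ : Equiv.Perm (Fin m) := Tuple.sort fun i : Fin m => -|φ i|
  have hσ : Antitone fun i => |φ (σ i)| := fun i j hij => by
    have := Tuple.monotone_sort (fun i : Fin m => -|φ i|) hij
    simpa using this
  let w : ℕ → ℝ := fun k => if hk : k < m then |φ (σ ⟨k, hk⟩)| else 0
  have hwσ : ∀ i : Fin m, w i = |φ (σ i)| := fun i => by simp [w]
  have hw0 : ∀ k, 0 ≤ w k := fun k => by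
    simp only [w]
    split_ifs
    exacts [abs_nonneg _, le_rfl]
  have hw : Antitone w := fun i j hij => by
    by_cases hj : j < m
    · have hi : i < m := hij.trans_lt hj
      have := hσ (show (⟨i, hi⟩ : Fin m) ≤ ⟨j, hj⟩ from hij)
      simpa [w, hi, hj] using this
    · simpa [w, hj] using hw0 i
  let θ : Equiv.Perm ℕ := (σ⁻¹).extendDomain (Fin.equivSubtype (n := m))
  have hθfin : ∀ i : Fin m, θ i = σ⁻¹ i := fun i =>
    Equiv.Perm.extendDomain_apply_image σ⁻¹ Fin.equivSubtype i
  have hθlt : ∀ k, θ k < m ↔ k < m := fun k => by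
    by_cases hk : k < m
    · have := hθfin ⟨k, hk⟩
      simp only at this
      simp [this, hk]
    · have : θ k = k := Equiv.Perm.extendDomain_apply_not_subtype _ _ hk
      rw [this]
  let z : ℕ → ℝ := fun k => if φ k < 0 then -y (θ k) else y (θ k)
  have hz : Φ.onTrunc m z = Φ.onTrunc m y := Φ.onTrunc_eq_of_abs_eq θ hθlt fun k => by
    simp only [z]
    split_ifs <;> simp
  have hφz : ∀ k, φ k * z k = |φ k| * y (θ k) := fun k => by
    simp only [z]
    split_ifs with hk
    · rw [abs_of_neg hk]; ring
    · rw [abs_of_nonneg (not_lt.mp hk)]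
  calc Φ.onTrunc m x = ∑ k ∈ Finset.range m, φ k * x k := hφx.symm
    _ ≤ ∑ k ∈ Finset.range m, |φ k| * x k := Finset.sum_le_sum fun k _ =>
        mul_le_mul_of_nonneg_right (le_abs_self _) (hx0 k)
    _ = ∑ i : Fin m, x i * |φ (σ (σ⁻¹ i))| := by
        rw [← Fin.sum_univ_eq_sum_range (fun k => |φ k| * x k) m]
        exact Finset.sum_congr rfl fun i _ => by simp [mul_comm]
    _ ≤ ∑ i : Fin m, x i * |φ (σ i)| := by
        refine Monovary.sum_mul_comp_perm_le_sum_mul (f := fun i : Fin m => x i)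
          (g := fun i => |φ (σ i)|) ?_
        exact Antitone.monovary (fun i j hij => hx hij) hσ
    _ = ∑ k ∈ Finset.range m, w k * x k := by
        rw [← Fin.sum_univ_eq_sum_range (fun k => w k * x k) m]
        exact Finset.sum_congr rfl fun i _ => by rw [hwσ, mul_comm]
    _ ≤ ∑ k ∈ Finset.range m, w k * y k := sum_mul_le_sum_mul_of_antitone hw hw0 h m
    _ = ∑ i : Fin m, |φ (σ i)| * y (θ (σ i)) := by
        rw [← Fin.sum_univ_eq_sum_range (fun k => w k * y k) m]
        exact Finset.sum_congr rfl fun i _ => by rw [hwσ, hθfin]; simp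
    _ = ∑ i : Fin m, |φ i| * y (θ i) := Equiv.sum_comp σ fun i : Fin m => |φ i| * y (θ i)
    _ = ∑ k ∈ Finset.range m, φ k * z k := by
        rw [Fin.sum_univ_eq_sum_range (fun k => |φ k| * y (θ k)) m]
        exact Finset.sum_congr rfl fun k _ => (hφz k).symm
    _ ≤ Φ.onTrunc m z := hφ z
    _ = Φ.onTrunc m y := hz

/-! ### The main inequality -/

section Main

variable {H : Type*} [NormedAddCommGroup H] [InnerProductSpace ℂ H] [CompleteSpace H]

lemma snormSNF_opAbsPow (Φ : SymmNormingFun) (A : H →L[ℂ] H) {s : ℝ} (hs : 0 < s) :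
    snormSNF Φ (opAbsPow A s) = Φ.ext fun k => sNumber A k ^ s := by
  simp only [snormSNF, sNumber_opAbsPow A hs]

lemma ofReal_norm_rpow_le_snormSNF (Φ : SymmNormingFun) (A : H →L[ℂ] H) {s : ℝ} (hs : 0 < s) :
    ENNReal.ofReal (‖A‖ ^ s) ≤ snormSNF Φ (opAbsPow A s) := by
  rw [snormSNF_opAbsPow Φ A hs]
  refine le_trans (le_of_eq ?_) (Φ.ofReal_onTrunc_le_ext 1 _)
  rw [Φ.onTrunc_one, sNumber_zero_eq_norm, abs_of_nonneg (by positivity)]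

lemma summable_of_tsum_snormSNF_lt_top (Φ : SymmNormingFun) {s : ℝ} (hs : 0 < s) (hs1 : s ≤ 1)
    {A : ℕ → H →L[ℂ] H} (hA : ∑' j, snormSNF Φ (opAbsPow (A j) s) < ⊤) : Summable A := by
  have h1 : Summable fun j => ‖A j‖ ^ s := by
    have h2 : ∑' j, ENNReal.ofReal (‖A j‖ ^ s) ≠ ⊤ :=
      ((ENNReal.tsum_le_tsum fun j => ofReal_norm_rpow_le_snormSNF Φ (A j) hs).trans_lt hA).ne
    refine (ENNReal.summable_toReal h2).congr fun j => ?_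
    exact ENNReal.toReal_ofReal (by positivity)
  refine Summable.of_norm_bounded_eventually_nat h1 ?_
  filter_upwards [h1.tendsto_atTop_zero.eventually_lt_const zero_lt_one] with j hj
  have h3 : ‖A j‖ ≤ 1 := by
    by_contra! hlt
    exact hj.not_ge (Real.one_le_rpow hlt.le hs.le)
  simpa using Real.rpow_le_rpow_of_exponent_ge' (norm_nonneg (A j)) h3 hs.le hs1

lemma ofReal_onTrunc_sNumber_rpow_sum_le (Φ : SymmNormingFun) {ι : Type*} (J : Finset ι)
    (A : ι → H →L[ℂ] H) {s : ℝ} (hs : 0 < s) (hs1 : s ≤ 1) (m : ℕ) :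
    ENNReal.ofReal (Φ.onTrunc m fun k => sNumber (∑ j ∈ J, A j) k ^ s) ≤
      2 * ∑ j ∈ J, snormSNF Φ (opAbsPow (A j) s) := by
  have h1 : Φ.onTrunc m (fun k => sNumber (∑ j ∈ J, A j) k ^ s) ≤
      2 * ∑ j ∈ J, Φ.onTrunc m fun k => sNumber (A j) k ^ s := by
    calc Φ.onTrunc m (fun k => sNumber (∑ j ∈ J, A j) k ^ s)
        ≤ Φ.onTrunc m ((2 : ℝ) • ∑ j ∈ J, fun k => sNumber (A j) k ^ s) := by
          refine Φ.onTrunc_le_of_sum_le (fun i j hij => Real.rpow_le_rpow (sNumber_nonneg _ _)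
            (sNumber_antitone _ hij) hs.le) (fun k => Real.rpow_nonneg (sNumber_nonneg _ k) s)
            (fun n => ?_) m
          refine (sum_sNumber_rpow_sum_le J A n hs hs1).trans (le_of_eq ?_)
          simp only [Pi.smul_apply, Finset.sum_apply, smul_eq_mul]
          rw [← Finset.mul_sum, Finset.sum_comm]
      _ = 2 * Φ.onTrunc m (∑ j ∈ J, fun k => sNumber (A j) k ^ s) := by
          rw [Φ.onTrunc_smul, abs_two]
      _ ≤ _ := by
          gcongr
          exact Φ.onTrunc_sum_le m J _
  refine (ENNReal.ofReal_le_ofReal h1).trans ?_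
  rw [ENNReal.ofReal_mul zero_le_two, ENNReal.ofReal_ofNat,
    ENNReal.ofReal_sum_of_nonneg fun j _ => Φ.onTrunc_nonneg m _]
  gcongr with j _
  rw [snormSNF_opAbsPow Φ (A j) hs]
  exact Φ.ofReal_onTrunc_le_ext m _

lemma snormSNF_opAbsPow_le_of_hasSum (Φ : SymmNormingFun) {s : ℝ} (hs : 0 < s) (hs1 : s ≤ 1)
    {A : ℕ → H →L[ℂ] H} {S : H →L[ℂ] H} (hS : HasSum A S) :
    snormSNF Φ (opAbsPow S s) ≤ 2 * ∑' j, snormSNF Φ (opAbsPow (A j) s) := by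
  rw [snormSNF_opAbsPow Φ S hs]
  refine iSup_le fun m => ?_
  change ENNReal.ofReal (Φ.onTrunc m fun k => sNumber S k ^ s) ≤ _
  let P : ℕ → H →L[ℂ] H := fun N => ∑ j ∈ Finset.range N, A j
  have hP : Filter.Tendsto P Filter.atTop (nhds S) := hS.tendsto_sum_nat
  have hs_tendsto : ∀ k, Filter.Tendsto (fun N => sNumber (P N) k) Filter.atTop
      (nhds (sNumber S k)) := fun k => by
    rw [tendsto_iff_dist_tendsto_zero]
    refine squeeze_zero (fun _ => dist_nonneg) (fun N => abs_sNumber_sub_le (P N) S k) ?_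
    simpa [dist_eq_norm] using tendsto_iff_dist_tendsto_zero.mp hP
  let e : ℕ → ℝ := fun N => ∑ k ∈ Finset.range m, |sNumber S k ^ s - sNumber (P N) k ^ s|
  have he : Filter.Tendsto (fun N => ENNReal.ofReal (e N)) Filter.atTop (nhds 0) := by
    rw [← ENNReal.ofReal_zero]
    refine ENNReal.tendsto_ofReal ?_
    rw [← Finset.sum_const_zero (s := Finset.range m)]
    refine tendsto_finsetSum _ fun k _ => ?_
    have := ((hs_tendsto k).rpow_const (Or.inr hs.le)).const_sub (sNumber S k ^ s)
    simpa using this.abs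
  have hbound : ∀ N, ENNReal.ofReal (Φ.onTrunc m fun k => sNumber S k ^ s) ≤
      2 * ∑' j, snormSNF Φ (opAbsPow (A j) s) + ENNReal.ofReal (e N) := fun N => by
    have h1 : Φ.onTrunc m (fun k => sNumber S k ^ s) ≤
        Φ.onTrunc m (fun k => sNumber (P N) k ^ s) + e N := by
      have h2 := Φ.onTrunc_add_le m (fun k => sNumber (P N) k ^ s)
        (fun k => sNumber S k ^ s - sNumber (P N) k ^ s)
      have h3 : ((fun k => sNumber (P N) k ^ s) + fun k => sNumber S k ^ s - sNumber (P N) k ^ s) =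
          fun k => sNumber S k ^ s := by
        ext k
        simp
      rw [h3] at h2
      exact h2.trans (by gcongr; exact Φ.onTrunc_le_sum_abs m _)
    refine (ENNReal.ofReal_le_ofReal h1).trans (ENNReal.ofReal_add_le.trans ?_)
    gcongr
    refine (ofReal_onTrunc_sNumber_rpow_sum_le Φ (Finset.range N) A hs hs1 m).trans ?_
    gcongr
    exact ENNReal.sum_le_tsum _
  have hlim := he.const_add (2 * ∑' j, snormSNF Φ (opAbsPow (A j) s))
  rw [add_zero] at hlim
  exact ge_of_tendsto' hlim hbound

end Main

/-- **Proposition.** For every symmetric norming function `Φ` there is a constant `C > 0`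
(depending only on `Φ`) such that for all `0 < s ≤ 1` and every sequence `{H_j}` of bounded
operators with `Σ_j ||H_j|^s|_Φ < ∞`, the series `Σ_j H_j` converges in operator norm and
`||Σ_j H_j|^s|_Φ ≤ C · 2^{1-s} · Σ_j ||H_j|^s|_Φ`. -/
theorem snorm_abs_pow_sum_le
    {H : Type*} [NormedAddCommGroup H] [InnerProductSpace ℂ H] [CompleteSpace H]
    [TopologicalSpace.SeparableSpace H] (Φ : SymmNormingFun) :
    ∃ C : ℝ, 0 < C ∧ ∀ s : ℝ, 0 < s → s ≤ 1 → ∀ Hj : ℕ → H →L[ℂ] H,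
      (∑' j, snormSNF Φ (opAbsPow (Hj j) s)) < ⊤ →
      ∃ S : H →L[ℂ] H, HasSum Hj S ∧
        snormSNF Φ (opAbsPow S s) ≤
          ENNReal.ofReal (C * 2 ^ (1 - s)) * ∑' j, snormSNF Φ (opAbsPow (Hj j) s) := by
  refine ⟨2, two_pos, fun s hs hs1 Hj hfin => ?_⟩
  have hsum := (summable_of_tsum_snormSNF_lt_top Φ hs hs1 hfin).hasSum
  refine ⟨_, hsum, (snormSNF_opAbsPow_le_of_hasSum Φ hs hs1 hsum).trans ?_⟩
  gcongr
  rw [← ENNReal.ofReal_ofNat]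
  refine ENNReal.ofReal_le_ofReal (le_mul_of_one_le_right zero_le_two ?_)
  exact Real.one_le_rpow one_le_two (sub_nonneg.mpr hs1)
end
end
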